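/- Let Q be an extended Dynkin quiver which is not an oriented cycle, k a finite field with q elements, M a simple preinjective kQ-module and N an indecomposable preprojective kQ-module; set d = dim_k Hom(N,M). Then there exists an epimorphism N ↠ M^d, unique up to an automorphism of M^d; its kernel P satisfies Hom(P,M) = 0, Ext^1(P,N) = 0 and Ext^1(P,P) = 0. Moreover, if X is a regular module, either homogeneous or lying in a single non-homogeneous tube, which is an extension of M by N (i.e. there is a short exact sequence 0 → N → X → M → 0), then F_{MN}^X = (q^{d+1} − 1)/(q − 1) − Σ_{[L] decomposable} F_{ML}^X · F_{M^d P}^L, the sum running over isomorphism classes of decomposable modules L. -/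

import Mathlib

open Polynomial

/-- A finite quiver, given by a finite set of vertices, a finite set of arrows,
and source/target maps. -/
structure QuiverData where
  V : Type
  A : Type
  [fintV : Fintype V]
  [decV : DecidableEq V]
  [fintA : Fintype A]
  s : A → V
  t : A → V

attribute [instance] QuiverData.fintV QuiverData.decV QuiverData.fintA

/-- A representation of a quiver over a field `k`:  a finite dimensional vector
space at each vertex together with a linear map for each arrow.  This is the same
thing as a `kQ`-module (finite dimensionality is imposed separately via `FinDim`). -/
structure Repn (k : Type) [Field k] (Q : QuiverData) where
  space : Q.V → Type
  [addcg : ∀ v, AddCommGroup (space v)]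
  [mod : ∀ v, Module k (space v)]
  map : ∀ a : Q.A, space (Q.s a) →ₗ[k] space (Q.t a)

attribute [instance] Repn.addcg Repn.mod

namespace Repn

variable {k : Type} [Field k] {Q : QuiverData}

/-- An isomorphism of representations. -/
structure Iso (M N : Repn k Q) where
  e : ∀ v, M.space v ≃ₗ[k] N.space v
  comm : ∀ (a : Q.A) (x : M.space (Q.s a)), e (Q.t a) (M.map a x) = N.map a (e (Q.s a) x)

/-- Direct sum of two representations. -/
def dsum (M N : Repn k Q) : Repn k Q where
  space v := M.space v × N.space v
  map a := (M.map a).prodMap (N.map a)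

/-- Direct sum of a family of representations. -/
def dsumFam {ι : Type} (X : ι → Repn k Q) : Repn k Q where
  space v := ∀ i, (X i).space v
  map a := LinearMap.pi fun i => ((X i).map a).comp (LinearMap.proj i)

/-- The zero representation(s). -/
def IsZero (M : Repn k Q) : Prop := ∀ (v : Q.V) (x : M.space v), x = 0

/-- Pointwise finite dimensionality, i.e. `M` is a finite `kQ`-module. -/
def FinDim (M : Repn k Q) : Prop := ∀ v, FiniteDimensional k (M.space v)

/-- Indecomposability. -/
def Indec (M : Repn k Q) : Prop :=
  ¬ M.IsZero ∧ ∀ Y Z : Repn k Q, Nonempty (Iso M (Y.dsum Z)) → Y.IsZero ∨ Z.IsZero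

/-- The dimension vector. -/
noncomputable def dimv (M : Repn k Q) : Q.V → ℕ := fun v => Module.finrank k (M.space v)

end Repn

/-- A subrepresentation of `X`, i.e. a `kQ`-submodule. -/
structure Subrep {k : Type} [Field k] {Q : QuiverData} (X : Repn k Q) where
  sub : ∀ v, Submodule k (X.space v)
  stable : ∀ a : Q.A, (sub (Q.s a)).map (X.map a) ≤ sub (Q.t a)

namespace Subrep

variable {k : Type} [Field k] {Q : QuiverData} {X : Repn k Q}

/-- A subrepresentation as a representation. -/
def repn (U : Subrep X) : Repn k Q where
  space v := U.sub v
  map a := (X.map a).restrict fun _ hx => U.stable a (Submodule.mem_map_of_mem hx)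

/-- The quotient representation `X/U`. -/
def quot (U : Subrep X) : Repn k Q where
  space v := X.space v ⧸ U.sub v
  map a := Submodule.mapQ (U.sub (Q.s a)) (U.sub (Q.t a)) (X.map a)
    (Submodule.map_le_iff_le_comap.mp (U.stable a))

end Subrep

/-- The Hall number `F_{MN}^X`: the number of subrepresentations `U ≤ X` with
`U ≅ N` and `X/U ≅ M`. -/
noncomputable def hallNum {k : Type} [Field k] {Q : QuiverData} (M N X : Repn k Q) : ℕ :=
  Nat.card {U : Subrep X // Nonempty (Repn.Iso U.repn N) ∧ Nonempty (Repn.Iso U.quot M)}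

/-- The number of automorphisms of a representation. -/
noncomputable def autCard {k : Type} [Field k] {Q : QuiverData} (M : Repn k Q) : ℕ :=
  Nat.card (Repn.Iso M M)

/-- The Euler form of the quiver `Q`. -/
def eulerZ (Q : QuiverData) (d e : Q.V → ℤ) : ℤ :=
  (∑ v, d v * e v) - ∑ a, d (Q.s a) * e (Q.t a)

/-- The Tits quadratic form of `Q`. -/
def titsZ (Q : QuiverData) (d : Q.V → ℤ) : ℤ := eulerZ Q d d

/-- Coercion of a dimension vector to an integral vector. -/
def natc {Q : QuiverData} (d : Q.V → ℕ) : Q.V → ℤ := fun v => (d v : ℤ)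

/-- Connectedness of the underlying graph of `Q`. -/
def QuiverData.Connected (Q : QuiverData) : Prop :=
  ∀ u v : Q.V, Relation.ReflTransGen
    (fun x y => ∃ a, (Q.s a = x ∧ Q.t a = y) ∨ (Q.s a = y ∧ Q.t a = x)) u v

/-- `Q` is a Dynkin quiver iff it is connected and its Tits form is positive definite. -/
def IsDynkin (Q : QuiverData) : Prop :=
  Q.Connected ∧ ∀ d : Q.V → ℤ, d ≠ 0 → 0 < titsZ Q d

/-- `Q` is an extended Dynkin (affine) quiver iff it is connected and its Tits form is
positive semidefinite but not definite. -/
def IsAffine (Q : QuiverData) : Prop :=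
  Q.Connected ∧ (∀ d : Q.V → ℤ, 0 ≤ titsZ Q d) ∧ ∃ d : Q.V → ℤ, d ≠ 0 ∧ titsZ Q d = 0

/-- `δ` is the minimal positive imaginary root of the affine quiver `Q`. -/
def IsMinImagRoot (Q : QuiverData) (δ : Q.V → ℕ) : Prop :=
  δ ≠ 0 ∧ titsZ Q (natc δ) = 0 ∧
    ∀ d : Q.V → ℕ, d ≠ 0 → titsZ Q (natc d) = 0 → ∀ v, δ v ≤ d v

/-- `Q` is an oriented cycle iff every vertex has exactly one incoming and one
outgoing arrow (`Q` being connected). -/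
def IsOrientedCycle (Q : QuiverData) : Prop :=
  ∀ v : Q.V, Nat.card {a : Q.A // Q.s a = v} = 1 ∧ Nat.card {a : Q.A // Q.t a = v} = 1

/-- The standard map whose kernel is `Hom(M,N)` and whose cokernel is `Ext¹(M,N)`. -/
noncomputable def extMap {k : Type} [Field k] {Q : QuiverData} (M N : Repn k Q) :
    (∀ v, M.space v →ₗ[k] N.space v) →ₗ[k] (∀ a : Q.A, M.space (Q.s a) →ₗ[k] N.space (Q.t a)) :=
  LinearMap.pi fun a =>
    ((LinearMap.llcomp k (M.space (Q.s a)) (N.space (Q.s a)) (N.space (Q.t a)) (N.map a)).comp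
        (LinearMap.proj (Q.s a)))
      - ((LinearMap.lcomp k (N.space (Q.t a)) (M.map a)).comp (LinearMap.proj (Q.t a)))

/-- `dim_k Hom(M,N)`. -/
noncomputable def homDim {k : Type} [Field k] {Q : QuiverData} (M N : Repn k Q) : ℕ :=
  Module.finrank k (LinearMap.ker (extMap M N))

/-- `dim_k Ext¹(M,N)`. -/
noncomputable def extDim {k : Type} [Field k] {Q : QuiverData} (M N : Repn k Q) : ℕ :=
  Module.finrank k
    ((∀ a : Q.A, M.space (Q.s a) →ₗ[k] N.space (Q.t a)) ⧸ LinearMap.range (extMap M N))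

section Affine

variable {k : Type} [Field k] {Q : QuiverData}

/-- The defect `∂(d) = ⟨δ, d⟩`. -/
def defectOf (Q : QuiverData) (δ : Q.V → ℕ) (d : Q.V → ℤ) : ℤ := eulerZ Q (natc δ) d

/-- An indecomposable preprojective module (negative defect). -/
def IsPreprojIndec (δ : Q.V → ℕ) (M : Repn k Q) : Prop :=
  M.Indec ∧ M.FinDim ∧ defectOf Q δ (natc (Repn.dimv M)) < 0

/-- An indecomposable preinjective module (positive defect). -/
def IsPreinjIndec (δ : Q.V → ℕ) (M : Repn k Q) : Prop :=
  M.Indec ∧ M.FinDim ∧ 0 < defectOf Q δ (natc (Repn.dimv M))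

/-- An indecomposable regular module (zero defect). -/
def IsRegIndec (δ : Q.V → ℕ) (M : Repn k Q) : Prop :=
  M.Indec ∧ M.FinDim ∧ defectOf Q δ (natc (Repn.dimv M)) = 0

/-- Two indecomposable regular modules lie in the same tube iff they are connected by a
chain of nonzero homomorphisms among indecomposable regular modules. -/
def SameTube (δ : Q.V → ℕ) (X Y : Repn k Q) : Prop :=
  Relation.EqvGen
    (fun M N => IsRegIndec δ M ∧ IsRegIndec δ N ∧ (homDim M N ≠ 0 ∨ homDim N M ≠ 0)) X Y

/-- An indecomposable regular module lies in a homogeneous tube iff the dimension vector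
of every indecomposable in its tube is a multiple of `δ`. -/
def InHomogTube (δ : Q.V → ℕ) (X : Repn k Q) : Prop :=
  IsRegIndec δ X ∧
    ∀ Y : Repn k Q, IsRegIndec δ Y → SameTube δ X Y → ∃ m : ℕ, ∀ v, Repn.dimv Y v = m * δ v

/-- `M` decomposes as a finite direct sum of modules satisfying `P`. -/
def DecompInto (P : Repn k Q → Prop) (M : Repn k Q) : Prop :=
  ∃ (ι : Type) (_ : Fintype ι) (Xi : ι → Repn k Q),
    (∀ i, P (Xi i)) ∧ Nonempty (Repn.Iso M (Repn.dsumFam Xi))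

/-- A regular module: a direct sum of indecomposable regular modules. -/
def IsRegularModule (δ : Q.V → ℕ) (M : Repn k Q) : Prop :=
  DecompInto (IsRegIndec δ) M

/-- A homogeneous regular module: all indecomposable summands lie in homogeneous tubes. -/
def IsHomogRegular (δ : Q.V → ℕ) (M : Repn k Q) : Prop :=
  DecompInto (InHomogTube δ) M

/-- A regular module lying in a single non-homogeneous tube. -/
def SingleNonHomogTube (δ : Q.V → ℕ) (M : Repn k Q) : Prop :=
  ∃ (ι : Type) (_ : Fintype ι) (Xi : ι → Repn k Q),
    (∀ i, IsRegIndec δ (Xi i) ∧ ¬ InHomogTube δ (Xi i)) ∧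
    (∀ i j, SameTube δ (Xi i) (Xi j)) ∧
    Nonempty (Repn.Iso M (Repn.dsumFam Xi))

/-- A regular subobject: a subrepresentation which is regular with regular quotient. -/
def IsRegSub (δ : Q.V → ℕ) {X : Repn k Q} (U : Subrep X) : Prop :=
  IsRegularModule δ U.repn ∧ IsRegularModule δ U.quot

/-- A regular simple (quasi-simple) module: a simple object of the abelian category of
regular modules. -/
def IsRegSimple (δ : Q.V → ℕ) (X : Repn k Q) : Prop :=
  IsRegIndec δ X ∧
    ∀ U : Subrep X, IsRegSub δ U → (U.repn).IsZero ∨ (U.quot).IsZero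

/-- `X` has a filtration by `ℓ` regular simples (i.e. `X` is regular of quasi-length `ℓ`). -/
def HasRegFilt (δ : Q.V → ℕ) : ℕ → Repn k Q → Prop
  | 0, X => X.IsZero
  | (ℓ+1), X => ∃ U : Subrep X,
      IsRegSimple δ U.quot ∧ IsRegularModule δ U.repn ∧ HasRegFilt δ ℓ U.repn

/-- The regular socle of `X` has dimension vector `d`. -/
def QuasiSocleDim (δ : Q.V → ℕ) (X : Repn k Q) (d : Q.V → ℕ) : Prop :=
  ∃ U : Subrep X, IsRegSimple δ U.repn ∧ IsRegularModule δ U.quot ∧ Repn.dimv U.repn = d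

/-- `X` is the indecomposable module (containing no homogeneous regular summand)
specified by the combinatorial symbol `p = (d, ℓ)`:  if `∂(d) ≠ 0` then `X` is the
unique indecomposable (preprojective or preinjective) of dimension vector `d` (and
`ℓ = 1`); if `∂(d) = 0` then `X` is the indecomposable in a non-homogeneous tube with
regular socle of dimension vector `d` and quasi-length `ℓ`. -/
def RealizesIndecSymbol (δ : Q.V → ℕ) (X : Repn k Q) (p : (Q.V → ℕ) × ℕ) : Prop :=
  X.Indec ∧ X.FinDim ∧ ¬ InHomogTube δ X ∧
    ((defectOf Q δ (natc p.1) ≠ 0 ∧ p.2 = 1 ∧ Repn.dimv X = p.1) ∨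
     (defectOf Q δ (natc p.1) = 0 ∧ QuasiSocleDim δ X p.1 ∧ HasRegFilt δ p.2 X))

/-- `X` is a direct summand of `R`. -/
def SummandOf (X R : Repn k Q) : Prop :=
  ∃ Z : Repn k Q, Nonempty (Repn.Iso R (X.dsum Z))

/-- `R` is the homogeneous regular module `R(λ,x)` for some point `x` of degree `d`,
where `p = (λ, d)`:  a direct sum, over the parts `c` of `λ`, of indecomposables of
quasi-length `c` all lying in one homogeneous tube whose quasi-simple has dimension
vector `d·δ`. -/
def RealizesHomogPair (δ : Q.V → ℕ) (R : Repn k Q) (p : Multiset ℕ+ × ℕ+) : Prop :=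
  ∃ (ι : Type) (hι : Fintype ι) (Xi : ι → Repn k Q) (len : ι → ℕ+),
    (∀ i, InHomogTube δ (Xi i) ∧
      QuasiSocleDim δ (Xi i) (fun v => (p.2 : ℕ) * δ v) ∧
      HasRegFilt δ (len i : ℕ) (Xi i)) ∧
    (∀ i j, SameTube δ (Xi i) (Xi j)) ∧
    Multiset.map len hι.elems.val = p.1 ∧
    Nonempty (Repn.Iso R (Repn.dsumFam Xi))

/-- No indecomposable regular summand of `R` shares a tube with one of `R'`. -/
def TubeDisjoint (δ : Q.V → ℕ) (R R' : Repn k Q) : Prop :=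
  ∀ X Y : Repn k Q, SummandOf X R → SummandOf Y R' →
    IsRegIndec δ X → IsRegIndec δ Y → ¬ SameTube δ X Y

end Affine

/-- A decomposition symbol `α = (μ, σ)` (Bongartz–Dudek):  `μ` is a multiset of
combinatorial symbols specifying a module without homogeneous regular summands, and
`σ` is a Segre symbol, i.e. a multiset of pairs (partition, degree). -/
def DSymb (Q : QuiverData) : Type :=
  Multiset ((Q.V → ℕ) × ℕ) × Multiset (Multiset ℕ+ × ℕ+)

section Classes

variable {k : Type} [Field k] {Q : QuiverData}

/-- `M` lies in the decomposition class `S(α,k)`:  `M ≅ M(μ,k) ⊕ R(λ_1,x_1) ⊕ ⋯ ⊕ R(λ_r,x_r)`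
where `M(μ,k)` is the module without homogeneous regular summands specified by `μ = α.1`
and the `x_i` are points lying in pairwise distinct homogeneous tubes, with partitions
and degrees prescribed by the Segre symbol `α.2`. -/
def InDecompClass (δ : Q.V → ℕ) (α : DSymb Q) (M : Repn k Q) : Prop :=
  ∃ D R : Repn k Q, Nonempty (Repn.Iso M (D.dsum R)) ∧
    (∃ (ι : Type) (hι : Fintype ι) (Xi : ι → Repn k Q) (tag : ι → (Q.V → ℕ) × ℕ),
      (∀ i, RealizesIndecSymbol δ (Xi i) (tag i)) ∧
      Multiset.map tag hι.elems.val = α.1 ∧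
      Nonempty (Repn.Iso D (Repn.dsumFam Xi))) ∧
    (∃ (κ : Type) (hκ : Fintype κ) (Rj : κ → Repn k Q) (ptag : κ → Multiset ℕ+ × ℕ+),
      (∀ j, RealizesHomogPair δ (Rj j) (ptag j)) ∧
      (∀ j j', j ≠ j' → TubeDisjoint δ (Rj j) (Rj j')) ∧
      Multiset.map ptag hκ.elems.val = α.2 ∧
      Nonempty (Repn.Iso R (Repn.dsumFam Rj)))

/-- The number of isomorphism classes of representations satisfying `P`. -/
noncomputable def classCount (P : Repn k Q → Prop) : ℕ :=
  Nat.card (Quot (fun (M N : {M : Repn k Q // P M}) => Nonempty (Repn.Iso M.1 N.1)))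

/-- `Σ_{A ∈ S(α,k), B ∈ S(β,k)} F_{AB}^C`: the number of subrepresentations `U ≤ C`
with `U` in the class `β` and `C/U` in the class `α`. -/
noncomputable def pairHallSum (αP βP : Repn k Q → Prop) (C : Repn k Q) : ℕ :=
  Nat.card {U : Subrep C // βP U.repn ∧ αP U.quot}

/-- `Σ_{B ∈ S(β,k), C ∈ S(γ,k)} F_{AB}^C` for a fixed module `A`:  the sum over the
isomorphism classes `C` in `S(γ,k)` of the number of `U ≤ C` with `U ∈ S(β,k)` and
`C/U ≅ A`. -/
noncomputable def hallSumFixedQuot (γP βP : Repn k Q → Prop) (A : Repn k Q) : ℕ :=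
  Nat.card (Σ c : Quot (fun (M N : {M : Repn k Q // γP M}) => Nonempty (Repn.Iso M.1 N.1)),
    {U : Subrep (c.out.1) // βP U.repn ∧ Nonempty (Repn.Iso U.quot A)})

/-- `Σ_{A ∈ S(α,k), C ∈ S(γ,k)} F_{AB}^C` for a fixed module `B`. -/
noncomputable def hallSumFixedSub (γP αP : Repn k Q → Prop) (B : Repn k Q) : ℕ :=
  Nat.card (Σ c : Quot (fun (M N : {M : Repn k Q // γP M}) => Nonempty (Repn.Iso M.1 N.1)),
    {U : Subrep (c.out.1) // Nonempty (Repn.Iso U.repn B) ∧ αP U.quot})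

end Classes

/-- `F` is a Hall polynomial for the decomposition symbols `(α, β; γ)`:  for every
finite field `k` with `q` elements,
`F(q) = Σ_{A ∈ S(α,k), B ∈ S(β,k)} F_{AB}^C` for all `C ∈ S(γ,k)`,
`n_γ(q)F(q) = n_α(q) Σ_{B ∈ S(β,k), C ∈ S(γ,k)} F_{AB}^C` for all `A ∈ S(α,k)`, and
`n_γ(q)F(q) = n_β(q) Σ_{A ∈ S(α,k), C ∈ S(γ,k)} F_{AB}^C` for all `B ∈ S(β,k)`,
where `n_α(q) = |S(α,k)|`. -/
def IsHallPoly (Q : QuiverData) (δ : Q.V → ℕ) (α β γ : DSymb Q) (F : Polynomial ℚ) : Prop :=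
  ∀ (k : Type) [Field k] [Fintype k],
    (∀ C : Repn k Q, InDecompClass δ γ C →
      (pairHallSum (InDecompClass δ α) (InDecompClass δ β) C : ℚ)
        = F.eval ((Fintype.card k : ℚ))) ∧
    (∀ A : Repn k Q, InDecompClass δ α A →
      (classCount (fun M : Repn k Q => InDecompClass δ γ M) : ℚ) * F.eval ((Fintype.card k : ℚ))
        = (classCount (fun M : Repn k Q => InDecompClass δ α M) : ℚ) *
            (hallSumFixedQuot (InDecompClass δ γ) (InDecompClass δ β) A : ℚ)) ∧
    (∀ B : Repn k Q, InDecompClass δ β B →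
      (classCount (fun M : Repn k Q => InDecompClass δ γ M) : ℚ) * F.eval ((Fintype.card k : ℚ))
        = (classCount (fun M : Repn k Q => InDecompClass δ β M) : ℚ) *
            (hallSumFixedSub (InDecompClass δ γ) (InDecompClass δ α) B : ℚ))

/-- The Hall polynomial for `(α, β; γ)` exists. -/
def HallPolyExists (Q : QuiverData) (δ : Q.V → ℕ) (α β γ : DSymb Q) : Prop :=
  ∃ F : Polynomial ℚ, IsHallPoly Q δ α β γ F

/-- A homomorphism of representations. -/
structure RepHom {k : Type} [Field k] {Q : QuiverData} (M N : Repn k Q) where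
  toFun : ∀ v, M.space v →ₗ[k] N.space v
  comm : ∀ a : Q.A, (N.map a).comp (toFun (Q.s a)) = (toFun (Q.t a)).comp (M.map a)

/-- The kernel of a homomorphism, as a subrepresentation of the source. -/
def RepHom.kerSub {k : Type} [Field k] {Q : QuiverData} {M N : Repn k Q}
    (f : RepHom M N) : Subrep M where
  sub v := LinearMap.ker (f.toFun v)
  stable a := by
    rintro _ ⟨x, hx, rfl⟩
    have h := congrArg (fun g : M.space (Q.s a) →ₗ[k] N.space (Q.t a) => g x) (f.comm a)
    simp only [LinearMap.comp_apply] at h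
    simp only [SetLike.mem_coe, LinearMap.mem_ker] at hx ⊢
    rw [← h, hx, map_zero]

/-- The direct sum of `d` copies of `M`. -/
def Repn.pow {k : Type} [Field k] {Q : QuiverData} (M : Repn k Q) (d : ℕ) : Repn k Q :=
  Repn.dsumFam (fun _ : Fin d => M)

/-- A simple representation. -/
def IsSimpleRep {k : Type} [Field k] {Q : QuiverData} (M : Repn k Q) : Prop :=
  ¬ M.IsZero ∧ ∀ U : Subrep M, (U.repn).IsZero ∨ (U.quot).IsZero

/-- A decomposable representation. -/
def IsDecomposableRep {k : Type} [Field k] {Q : QuiverData} (L : Repn k Q) : Prop :=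
  ∃ Y Z : Repn k Q, ¬ Y.IsZero ∧ ¬ Z.IsZero ∧ Nonempty (Repn.Iso L (Y.dsum Z))



set_option linter.unusedSectionVars false

namespace QNum

variable {V A : Type} [Fintype V] [DecidableEq V] [Fintype A]

/-- rational Euler form -/
noncomputable def EF (s t : A → V) : (V → ℚ) →ₗ[ℚ] (V → ℚ) →ₗ[ℚ] ℚ :=
  LinearMap.mk₂ ℚ (fun x y => (∑ v, x v * y v) - ∑ a, x (s a) * y (t a))
    (by intro x y z; simp only [Pi.add_apply, add_mul, Finset.sum_add_distrib]; ring)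
    (by intro c x y; simp only [Pi.smul_apply, smul_eq_mul, mul_assoc, ← Finset.mul_sum]; ring)
    (by intro x y z; simp only [Pi.add_apply, mul_add, Finset.sum_add_distrib]; ring)
    (by intro c x y; simp only [Pi.smul_apply, smul_eq_mul, mul_left_comm _ c, ← Finset.mul_sum]
        ring)

theorem EF_apply (s t : A → V) (x y : V → ℚ) :
    EF s t x y = (∑ v, x v * y v) - ∑ a, x (s a) * y (t a) := rfl

theorem EF_single_right (s t : A → V) (x : V → ℚ) (i : V) :
    EF s t x (Pi.single i 1) = x i - ∑ a with t a = i, x (s a) := by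
  simp [EF_apply, Pi.single_apply, Finset.sum_filter]

theorem EF_single_left (s t : A → V) (x : V → ℚ) (i : V) :
    EF s t (Pi.single i 1) x = x i - ∑ a with s a = i, x (t a) := by
  simp [EF_apply, Pi.single_apply, Finset.sum_filter]

theorem psd_transfer (s t : A → V)
    (h : ∀ d : V → ℤ, 0 ≤ (∑ v, d v * d v) - ∑ a, d (s a) * d (t a)) (y : V → ℚ) :
    0 ≤ EF s t y y := by
  obtain ⟨D, hD0, hD⟩ : ∃ D : ℕ, 0 < D ∧ ∀ v, ∃ z : ℤ, (z : ℚ) = D * y v := by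
    refine ⟨∏ v, (y v).den, Finset.prod_pos fun v _ => (y v).den_pos, fun v => ?_⟩
    refine ⟨(∏ w ∈ Finset.univ.erase v, (y w).den : ℕ) * (y v).num, ?_⟩
    rw [← Finset.mul_prod_erase _ _ (Finset.mem_univ v)]
    push_cast
    have := Rat.den_mul_eq_num (y v)
    rw [mul_right_comm, this, mul_comm]
  choose z hz using hD
  have h1 := h z
  have h2 : (((∑ v, z v * z v) - ∑ a, z (s a) * z (t a) : ℤ) : ℚ) = D ^ 2 * EF s t y y := by
    push_cast
    simp only [hz, EF_apply, mul_sub, Finset.mul_sum]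
    congr 1 <;> exact Finset.sum_congr rfl fun _ _ => by ring
  have h3 : (0 : ℚ) ≤ D ^ 2 * EF s t y y := by rw [← h2]; exact_mod_cast h1
  exact nonneg_of_mul_nonneg_right h3 (by positivity)

section
variable (s t : A → V) (hp : ∀ y, 0 ≤ EF s t y y)
  (hc : ∀ u v : V, Relation.ReflTransGen
    (fun x y => ∃ a, (s a = x ∧ t a = y) ∨ (s a = y ∧ t a = x)) u v)

theorem rad_of_zero (hp : ∀ y, 0 ≤ EF s t y y) (y : V → ℚ) (hy : EF s t y y = 0) (z : V → ℚ) :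
    EF s t y z + EF s t z y = 0 := by
  by_contra hne
  set c := EF s t y z + EF s t z y with hcd
  have h := hp (z + (-(EF s t z z + 1) / c) • y)
  simp only [map_add, map_smul, LinearMap.add_apply, LinearMap.smul_apply, smul_eq_mul, hy] at h
  have : (-(EF s t z z + 1) / c) * c = -(EF s t z z + 1) := by field_simp
  rw [hcd] at this
  rw [← hcd] at this
  nlinarith

theorem rad_zero 
    (hc : ∀ u v : V, Relation.ReflTransGen
    (fun x y => ∃ a, (s a = x ∧ t a = y) ∨ (s a = y ∧ t a = x)) u v)
    (y : V → ℚ) (h0 : ∀ v, 0 ≤ y v)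
    (hr : ∀ z, EF s t y z + EF s t z y = 0) (v : V) (hv : y v = 0) : y = 0 := by
  funext w
  simp only [Pi.zero_apply]
  induction hc v w with
  | refl => exact hv
  | @tail b c _ hbc ih =>
    obtain ⟨a, ha⟩ := hbc
    have h := hr (Pi.single b 1)
    rw [EF_single_left, EF_single_right, ih] at h
    have h1 : 0 ≤ ∑ a with t a = b, y (s a) := Finset.sum_nonneg fun _ _ => h0 _
    have h2 : 0 ≤ ∑ a with s a = b, y (t a) := Finset.sum_nonneg fun _ _ => h0 _
    rcases ha with ⟨hs, ht⟩ | ⟨hs, ht⟩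
    · have h3 : ∑ a with s a = b, y (t a) = 0 := by linarith
      rw [Finset.sum_eq_zero_iff_of_nonneg fun _ _ => h0 _] at h3
      rw [← ht]; exact h3 a (by simp [hs])
    · have h3 : ∑ a with t a = b, y (s a) = 0 := by linarith
      rw [Finset.sum_eq_zero_iff_of_nonneg fun _ _ => h0 _] at h3
      rw [← hs]; exact h3 a (by simp [ht])

theorem acyclic (hp : ∀ y, 0 ≤ EF s t y y)
    (hc : ∀ u v : V, Relation.ReflTransGen
    (fun x y => ∃ a, (s a = x ∧ t a = y) ∨ (s a = y ∧ t a = x)) u v)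
    (hnc : ¬ ∀ v, Nat.card {a // s a = v} = 1 ∧ Nat.card {a // t a = v} = 1)
    (D : Finset V) (hD : D.Nonempty) : ∃ i ∈ D, ∀ a, s a = i → t a ∉ D := by
  classical
  by_contra hcon
  push Not at hcon
  have hA : Nonempty A := by
    obtain ⟨i, hi⟩ := hD
    obtain ⟨a, _⟩ := hcon i hi
    exact ⟨a⟩
  choose! f hf1 hf2 using hcon
  set y : V → ℚ := fun v => if v ∈ D then 1 else 0 with hy
  have hcard : D.card ≤ (Finset.univ.filter fun a => s a ∈ D ∧ t a ∈ D).card := by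
    refine Finset.card_le_card_of_injOn f ?_ ?_
    · intro i hi
      have hi' : i ∈ D := hi
      simp [hf1 i hi', hf2 i hi', hi']
    · intro i hi j hj hij
      rw [← hf1 i hi, ← hf1 j hj, hij]
  have hE : EF s t y y = D.card - (Finset.univ.filter fun a => s a ∈ D ∧ t a ∈ D).card := by
    simp only [EF_apply, hy, Finset.card_eq_sum_ones, Finset.sum_filter]
    push_cast
    congr 1
    · simp
    · refine Finset.sum_congr rfl fun a _ => ?_
      by_cases h1 : s a ∈ D <;> by_cases h2 : t a ∈ D <;> simp [h1, h2]
  have hE0 : EF s t y y = 0 := by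
    have h1 := hp y
    have h2 : (D.card : ℚ) ≤ (Finset.univ.filter fun a => s a ∈ D ∧ t a ∈ D).card := by
      exact_mod_cast hcard
    linarith
  have hr := rad_of_zero s t hp y hE0
  have hall : ∀ v, v ∈ D := by
    intro v
    by_contra hv
    have := rad_zero s t hc y (fun v => by simp only [hy]; split_ifs <;> norm_num) hr v
      (by simp [hy, hv])
    obtain ⟨i, hi⟩ := hD
    have h2 := congrFun this i
    simp [hy, hi] at h2
  have hy1 : y = fun _ => 1 := by funext v; simp [hy, hall v]
  apply hnc
  have hout1 : ∀ v, 1 ≤ (Finset.univ.filter fun a => s a = v).card := fun v =>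
    Finset.card_pos.mpr ⟨f v, by simp [hf1 v (hall v)]⟩
  have hsum : ∑ v, (Finset.univ.filter fun a => s a = v).card = ∑ v : V, 1 := by
    rw [← Finset.card_eq_sum_card_fiberwise (fun a _ => Finset.mem_univ (s a))]
    rw [hE0, Finset.filter_true_of_mem (fun a _ => ⟨hall _, hall _⟩)] at hE
    have : D = Finset.univ := by ext v; simp [hall v]
    rw [this] at hE
    have h2 : ((Finset.univ : Finset V).card : ℚ) = (Finset.univ : Finset A).card := by linarith
    simp only [Finset.sum_const, smul_eq_mul, mul_one]
    exact_mod_cast h2.symm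
  have hout : ∀ v, (Finset.univ.filter fun a => s a = v).card = 1 := by
    intro v
    exact (((Finset.sum_eq_sum_iff_of_le (fun v _ => hout1 v)).mp hsum.symm) v
      (Finset.mem_univ v)).symm
  intro v
  have h := hr (Pi.single v 1)
  rw [EF_single_left, EF_single_right, hy1] at h
  simp only [Finset.sum_const, hout v] at h
  have hin : (Finset.univ.filter fun a => t a = v).card = 1 := by
    have : ((Finset.univ.filter fun a => t a = v).card : ℚ) = 1 := by
      simp at h; linarith
    exact_mod_cast this
  rw [Nat.card_eq_fintype_card, Nat.card_eq_fintype_card, Fintype.card_subtype,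
    Fintype.card_subtype]
  exact ⟨hout v, hin⟩

theorem ker_eq 
    (hc : ∀ u v : V, Relation.ReflTransGen
    (fun x y => ∃ a, (s a = x ∧ t a = y) ∨ (s a = y ∧ t a = x)) u v)
    [Nonempty V] (δ : V → ℚ) (hδ : ∀ v, 0 < δ v)
    (hδr : ∀ z, EF s t δ z + EF s t z δ = 0)
    (w : V → ℚ) (hw : ∀ z, EF s t w z + EF s t z w = 0) : ∃ c : ℚ, w = c • δ := by
  obtain ⟨v, hv⟩ := Finite.exists_min fun v => w v / δ v
  refine ⟨w v / δ v, ?_⟩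
  have := rad_zero s t hc (w - (w v / δ v) • δ) (fun u => by
    have h1 := (le_div_iff₀ (hδ u)).mp (hv u)
    simp only [Pi.sub_apply, Pi.smul_apply, smul_eq_mul]; linarith) (fun z => by
      simp only [map_sub, map_smul, LinearMap.sub_apply, LinearMap.smul_apply, smul_eq_mul]
      linear_combination hw z - (w v / δ v) * hδr z) v (by
      simp [(hδ v).ne'])
  exact sub_eq_zero.mp this

theorem func_repr
    (hc : ∀ u v : V, Relation.ReflTransGen
    (fun x y => ∃ a, (s a = x ∧ t a = y) ∨ (s a = y ∧ t a = x)) u v)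
    [Nonempty V] (δ : V → ℚ) (hδ : ∀ v, 0 < δ v)
    (hδr : ∀ z, EF s t δ z + EF s t z δ = 0)
    (l : (V → ℚ) →ₗ[ℚ] ℚ) (hl : l δ = 0) :
    ∃ w, ∀ z, l z = EF s t w z + EF s t z w := by
  let f : (V → ℚ) →ₗ[ℚ] Module.Dual ℚ (V → ℚ) := EF s t + (EF s t).flip
  have h1 : l ∈ (LinearMap.ker f).dualAnnihilator := by
    rw [Submodule.mem_dualAnnihilator]
    intro w hw
    obtain ⟨c, rfl⟩ := ker_eq s t hc δ hδ hδr w (fun z => by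
      have := congrArg (fun g : Module.Dual ℚ (V → ℚ) => g z) (LinearMap.mem_ker.mp hw)
      simpa [f] using this)
    rw [map_smul, hl, smul_zero]
  rw [← LinearMap.range_dualMap_eq_dualAnnihilator_ker] at h1
  obtain ⟨g, rfl⟩ := h1
  obtain ⟨w, rfl⟩ := (Module.evalEquiv ℚ (V → ℚ)).surjective g
  refine ⟨w, fun z => ?_⟩
  simp [f, add_comm]

theorem num (hp : ∀ y, 0 ≤ EF s t y y)
    (hc : ∀ u v : V, Relation.ReflTransGen
    (fun x y => ∃ a, (s a = x ∧ t a = y) ∨ (s a = y ∧ t a = x)) u v)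
    [Nonempty V] (δ : V → ℚ) (hδ : ∀ v, 0 < δ v)
    (hδr : ∀ z, EF s t δ z + EF s t z δ = 0)
    (x : ℕ → V → ℚ) (hx : ∀ n v, 0 ≤ x n v)
    (hx1 : ∀ n y, EF s t y (x (n+1)) = - EF s t (x n) y)
    (hneg : EF s t δ (x 0) < 0) : False := by
  have hd0 : EF s t δ δ = 0 := by have := hδr δ; linarith
  obtain ⟨u, hu⟩ := func_repr s t hc δ hδ hδr (-(EF s t δ)) (by simp [hd0])
  simp only [LinearMap.neg_apply] at hu
  have hdc : ∀ n, EF s t δ (x n) = EF s t δ (x 0) := by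
    intro n
    induction n with
    | zero => rfl
    | succ n ih => rw [hx1, ← ih]; have := hδr (x n); linarith
  have hqc : ∀ n, EF s t (x n) (x n) = EF s t (x 0) (x 0) := by
    intro n
    induction n with
    | zero => rfl
    | succ n ih => rw [hx1, hx1, ← ih]; ring
  have hψ : ∀ n : ℕ, EF s t u (x n) = EF s t u (x 0) + n * EF s t δ (x 0) := by
    intro n
    induction n with
    | zero => simp
    | succ n ih =>
      have h1 := hu (x n)
      rw [hx1]
      push_cast
      have := hdc n
      linarith
  have hψδ : 0 ≤ EF s t u δ := by
    have h1 := hδr u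
    have h2 := hu u
    have := hp u
    linarith
  obtain ⟨v⟩ := ‹Nonempty V›
  obtain ⟨w, hw⟩ := func_repr s t hc δ hδ hδr
    (EF s t u - (EF s t u δ / δ v) • LinearMap.proj v) (by
      simp [(hδ v).ne'])
  have hlow : ∀ n, -(EF s t w w + EF s t (x 0) (x 0)) ≤ EF s t u (x n) := by
    intro n
    have h1 := hw (x n)
    simp only [LinearMap.sub_apply, LinearMap.smul_apply, LinearMap.proj_apply, smul_eq_mul] at h1
    have h2 := hp (w + x n)
    simp only [map_add, LinearMap.add_apply, hqc n] at h2
    have h3 : 0 ≤ (EF s t u δ / δ v) * x n v := mul_nonneg (div_nonneg hψδ (hδ v).le) (hx n v)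
    linarith
  obtain ⟨n, hn⟩ := exists_nat_gt
    ((EF s t u (x 0) + (EF s t w w + EF s t (x 0) (x 0))) / (- EF s t δ (x 0)))
  rw [div_lt_iff₀ (by linarith)] at hn
  have h1 := hlow n
  rw [hψ n] at h1
  linarith

end
end QNum

/-! total-space representations -/

structure TRep (k V A : Type) [Field k] where
  E : Type
  [addcg : AddCommGroup E]
  [mod : Module k E]
  pr : V → E →ₗ[k] E
  T : A → E →ₗ[k] E

attribute [instance] TRep.addcg TRep.mod

set_option linter.unusedSectionVars false

namespace TRep

variable {k V A : Type} [Field k] [Fintype V] [DecidableEq V] [Fintype A]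

structure IsRep (s t : A → V) (X : TRep k V A) : Prop where
  idem : ∀ v x, X.pr v (X.pr v x) = X.pr v x
  orth : ∀ v w x, v ≠ w → X.pr v (X.pr w x) = 0
  sum : ∀ x, ∑ v, X.pr v x = x
  src : ∀ a x, X.T a (X.pr (s a) x) = X.T a x
  tgt : ∀ a x, X.pr (t a) (X.T a x) = X.T a x
  fin : FiniteDimensional k X.E


def IsHom (X Y : TRep k V A) (f : X.E →ₗ[k] Y.E) : Prop :=
  (∀ v x, f (X.pr v x) = Y.pr v (f x)) ∧ ∀ a x, f (X.T a x) = Y.T a (f x)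

def Ind (X : TRep k V A) : Prop :=
  (∃ x : X.E, x ≠ 0) ∧ ∀ e : X.E →ₗ[k] X.E, IsHom X X e → e ∘ₗ e = e → e = 0 ∨ e = LinearMap.id

noncomputable def dim (X : TRep k V A) (v : V) : ℤ :=
  (Module.finrank k (LinearMap.range (X.pr v)) : ℤ)

def Isom (X Y : TRep k V A) : Prop :=
  ∃ (f : X.E →ₗ[k] Y.E) (g : Y.E →ₗ[k] X.E), IsHom X Y f ∧ IsHom Y X g ∧
    (∀ x, g (f x) = x) ∧ ∀ y, f (g y) = y

/-- all indecomposables with dimension vector `x` are isomorphic with trivial endomorphisms -/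
def Claim (k : Type) [Field k] (s t : A → V) (x : V → ℤ) : Prop :=
  ∀ X : TRep k V A, IsRep s t X → Ind X → dim X = x →
    (∀ f, IsHom X X f → ∃ c : k, ∀ x, f x = c • x) ∧
    ∀ Y : TRep k V A, IsRep s t Y → Ind Y → dim Y = x → Isom X Y

/-- surjectivity at the sink `i` -/
def Good (s t : A → V) (i : V) (X : TRep k V A) : Prop :=
  ∃ σ : X.E →ₗ[k] (A → X.E), (∀ x a, t a ≠ i → σ x a = 0) ∧
    (∀ x a, X.pr (s a) (σ x a) = σ x a) ∧ ∀ x, ∑ a, X.T a (σ x a) = X.pr i x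

def reflSub (s t : A → V) (i : V) (X : TRep k V A) : Submodule k (X.E × (A → X.E)) where
  carrier := {p | X.pr i p.1 = 0 ∧ (∀ a, t a ≠ i → p.2 a = 0) ∧
    (∀ a, X.pr (s a) (p.2 a) = p.2 a) ∧ ∑ a, X.T a (p.2 a) = 0}
  zero_mem' := by simp
  add_mem' := by
    rintro p q ⟨h1, h2, h3, h4⟩ ⟨g1, g2, g3, g4⟩
    refine ⟨by simp [h1, g1], fun a ha => by simp [h2 a ha, g2 a ha],
      fun a => by simp [h3 a, g3 a], by simp [Finset.sum_add_distrib, h4, g4]⟩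
  smul_mem' := by
    rintro c p ⟨h1, h2, h3, h4⟩
    refine ⟨by simp [h1], fun a ha => by simp [h2 a ha],
      fun a => by simp [h3 a], by simp [← Finset.smul_sum, h4]⟩

def bigPr (i : V) (X : TRep k V A) (v : V) : (X.E × (A → X.E)) →ₗ[k] (X.E × (A → X.E)) :=
  if v = i then LinearMap.inr k _ _ ∘ₗ LinearMap.snd k _ _
  else LinearMap.inl k _ _ ∘ₗ X.pr v ∘ₗ LinearMap.fst k _ _

def bigT (t : A → V) (i : V) (X : TRep k V A) (a : A) :
    (X.E × (A → X.E)) →ₗ[k] (X.E × (A → X.E)) :=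
  if t a = i then LinearMap.inl k _ _ ∘ₗ LinearMap.proj a ∘ₗ LinearMap.snd k _ _
  else LinearMap.inl k _ _ ∘ₗ X.T a ∘ₗ LinearMap.fst k _ _

theorem bigPr_self (i : V) (X : TRep k V A) (p) : bigPr i X i p = (0, p.2) := by
  simp [bigPr]

theorem bigPr_ne (i : V) (X : TRep k V A) (v : V) (h : v ≠ i) (p) :
    bigPr i X v p = (X.pr v p.1, 0) := by
  simp [bigPr, h]

theorem bigT_eq (t : A → V) (i : V) (X : TRep k V A) (a : A) (h : t a = i) (p) :
    bigT t i X a p = (p.2 a, 0) := by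
  simp [bigT, h]

theorem bigT_ne (t : A → V) (i : V) (X : TRep k V A) (a : A) (h : t a ≠ i) (p) :
    bigT t i X a p = (X.T a p.1, 0) := by
  simp [bigT, h]

theorem mem_reflSub {s t : A → V} {i : V} {X : TRep k V A} {p} :
    p ∈ reflSub s t i X ↔ X.pr i p.1 = 0 ∧ (∀ a, t a ≠ i → p.2 a = 0) ∧
    (∀ a, X.pr (s a) (p.2 a) = p.2 a) ∧ ∑ a, X.T a (p.2 a) = 0 := Iff.rfl

theorem inl_mem {s t : A → V} {i : V} {X : TRep k V A} {x : X.E} (h : X.pr i x = 0) :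
    ((x, 0) : X.E × (A → X.E)) ∈ reflSub s t i X := by
  rw [mem_reflSub]; simp [h]

theorem inr_mem {s t : A → V} {i : V} {X : TRep k V A} {p : X.E × (A → X.E)}
    (h : p ∈ reflSub s t i X) :
    ((0, p.2) : X.E × (A → X.E)) ∈ reflSub s t i X := by
  rw [mem_reflSub] at h ⊢; simpa using h.2

theorem pr_T_ne {s t : A → V} {i : V} {X : TRep k V A} (hX : IsRep s t X) (a : A)
    (h : t a ≠ i) (x) : X.pr i (X.T a x) = 0 := by
  rw [← hX.tgt]; exact hX.orth _ _ _ (Ne.symm h)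

theorem bigPr_mem {s t : A → V} {i : V} {X : TRep k V A} (hX : IsRep s t X) (v : V) :
    ∀ p ∈ reflSub s t i X, bigPr i X v p ∈ reflSub s t i X := by
  intro p hp
  by_cases h : v = i
  · subst h; rw [bigPr_self]; exact inr_mem hp
  · rw [bigPr_ne _ _ _ h]; exact inl_mem (hX.orth _ _ _ (Ne.symm h))

theorem bigT_mem {s t : A → V} {i : V} {X : TRep k V A} (hX : IsRep s t X)
    (hs : ∀ a, s a ≠ i) (a : A) :
    ∀ p ∈ reflSub s t i X, bigT t i X a p ∈ reflSub s t i X := by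
  intro p hp
  by_cases h : t a = i
  · rw [bigT_eq _ _ _ _ h]; apply inl_mem
    rw [← hp.2.2.1 a]; exact hX.orth _ _ _ (Ne.symm (hs a))
  · rw [bigT_ne _ _ _ _ h]; exact inl_mem (pr_T_ne hX a h _)

/-- the reflection of `X` at the sink `i` -/
def refl {s t : A → V} {i : V} (X : TRep k V A) (hX : IsRep s t X)
    (hs : ∀ a, s a ≠ i) : TRep k V A where
  E := reflSub s t i X
  pr v := (bigPr i X v).restrict (bigPr_mem hX v)
  T a := (bigT t i X a).restrict (bigT_mem hX hs a)

section
variable {s t : A → V} {i : V} {X Y : TRep k V A} (hX : IsRep s t X) (hY : IsRep s t Y)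
  (hs : ∀ a, s a ≠ i)

/-- underlying pair of an element of the reflection -/
def rv : (refl X hX hs).E →ₗ[k] (X.E × (A → X.E)) := (reflSub s t i X).subtype

def rmk (p : X.E × (A → X.E)) (hp : p ∈ reflSub s t i X) : (refl X hX hs).E :=
  (⟨p, hp⟩ : reflSub s t i X)

theorem rv_rmk (p : X.E × (A → X.E)) (hp : p ∈ reflSub s t i X) :
    rv hX hs (rmk hX hs p hp) = p := rfl

theorem rv_mem (p : (refl X hX hs).E) : rv hX hs p ∈ reflSub s t i X :=
  Subtype.property (p := fun q => q ∈ reflSub s t i X) p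

theorem rv_inj {p q : (refl X hX hs).E} (h : rv hX hs p = rv hX hs q) : p = q :=
  Subtype.ext (p := fun q => q ∈ reflSub s t i X) h

theorem refl_pr_self (p : (refl X hX hs).E) :
    rv hX hs ((refl X hX hs).pr i p) = (0, (rv hX hs p).2) :=
  bigPr_self _ _ _

theorem refl_pr_ne (v : V) (h : v ≠ i) (p : (refl X hX hs).E) :
    rv hX hs ((refl X hX hs).pr v p) = (X.pr v (rv hX hs p).1, 0) :=
  bigPr_ne _ _ _ h _

theorem refl_T_eq (a : A) (h : t a = i) (p : (refl X hX hs).E) :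
    rv hX hs ((refl X hX hs).T a p) = ((rv hX hs p).2 a, 0) :=
  bigT_eq _ _ _ _ h _

theorem refl_T_ne (a : A) (h : t a ≠ i) (p : (refl X hX hs).E) :
    rv hX hs ((refl X hX hs).T a p) = (X.T a (rv hX hs p).1, 0) :=
  bigT_ne _ _ _ _ h _

theorem refl_isRep (s' t' : A → V) (h1 : ∀ a, t a = i → s' a = i ∧ t' a = s a)
    (h2 : ∀ a, t a ≠ i → s' a = s a ∧ t' a = t a) : IsRep s' t' (refl X hX hs) where
  idem v p := by
    apply rv_inj
    by_cases h : v = i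
    · subst h; rw [refl_pr_self, refl_pr_self]
    · rw [refl_pr_ne _ _ _ h, refl_pr_ne _ _ _ h, hX.idem]
  orth v w p hvw := by
    apply rv_inj
    by_cases h : v = i
    · subst h; rw [refl_pr_self, refl_pr_ne _ _ _ (Ne.symm hvw)]; rfl
    · rw [refl_pr_ne _ _ _ h]
      by_cases h' : w = i
      · subst h'; rw [refl_pr_self]; simp
      · rw [refl_pr_ne _ _ _ h', hX.orth _ _ _ hvw]; rfl
  sum p := by
    apply rv_inj
    rw [map_sum, ← Finset.add_sum_erase _ _ (Finset.mem_univ i),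
      refl_pr_self, Finset.sum_congr rfl (g := fun v => ((X.pr v (rv hX hs p).1, 0) : X.E × (A → X.E)))
      (fun v hv => refl_pr_ne hX hs v (Finset.ne_of_mem_erase hv) p)]
    have h := hX.sum (rv hX hs p).1
    rw [← Finset.add_sum_erase _ _ (Finset.mem_univ i), (rv_mem hX hs p).1, zero_add] at h
    apply Prod.ext
    · rw [Prod.fst_add, Prod.fst_sum]; simpa using h
    · rw [Prod.snd_add, Prod.snd_sum]; simp
  src a p := by
    apply rv_inj
    by_cases h : t a = i
    · rw [refl_T_eq _ _ _ h, refl_T_eq _ _ _ h, (h1 a h).1, refl_pr_self]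
    · rw [refl_T_ne _ _ _ h, refl_T_ne _ _ _ h, (h2 a h).1, refl_pr_ne _ _ _ (hs a), hX.src]
  tgt a p := by
    apply rv_inj
    by_cases h : t a = i
    · rw [(h1 a h).2, refl_pr_ne _ _ _ (hs a), refl_T_eq _ _ _ h, (rv_mem hX hs p).2.2.1]
    · rw [(h2 a h).2, refl_pr_ne _ _ _ h, refl_T_ne _ _ _ h, hX.tgt]
  fin := by
    have := hX.fin
    change FiniteDimensional k (reflSub s t i X)
    infer_instance

theorem reflMap_mem (f : X.E →ₗ[k] Y.E) (hf : IsHom X Y f) (p : X.E × (A → X.E))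
    (hp : p ∈ reflSub s t i X) :
    f.prodMap (f.compLeft A) p ∈ reflSub s t i Y := by
  obtain ⟨a1, a2, a3, a4⟩ := hp
  rw [mem_reflSub]
  refine ⟨?_, fun a ha => ?_, fun a => ?_, ?_⟩
  · simp [← hf.1, a1]
  · simp [a2 a ha]
  · simp [← hf.1, a3 a]
  · simp only [LinearMap.prodMap_apply, LinearMap.compLeft_apply, Function.comp, ← hf.2,
      ← map_sum, a4, map_zero]

def reflMap (f : X.E →ₗ[k] Y.E) (hf : IsHom X Y f) :
    (refl X hX hs).E →ₗ[k] (refl Y hY hs).E :=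
  (f.prodMap (f.compLeft A)).restrict (reflMap_mem f hf)

theorem reflMap_val (f : X.E →ₗ[k] Y.E) (hf : IsHom X Y f) (p : (refl X hX hs).E) :
    rv hY hs (reflMap hX hY hs f hf p) =
      (f (rv hX hs p).1, fun a => f ((rv hX hs p).2 a)) := rfl

theorem reflMap_inj (hG : Good s t i X) (f g : X.E →ₗ[k] Y.E) (hf : IsHom X Y f)
    (hg : IsHom X Y g) (h : ∀ p, reflMap hX hY hs f hf p = reflMap hX hY hs g hg p) : f = g := by
  have key : ∀ x, X.pr i x = 0 → f x = g x := by
    intro x hx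
    have := congrArg (fun p => (rv hY hs p).1) (h (rmk hX hs (x, 0) (inl_mem hx)))
    exact this
  obtain ⟨σ, h1, h2, h3⟩ := hG
  have key2 : ∀ x, f (X.pr i x) = g (X.pr i x) := by
    intro x
    rw [← h3, map_sum, map_sum]
    refine Finset.sum_congr rfl fun a _ => ?_
    rw [hf.2, hg.2, key]
    rw [← h2]; exact hX.orth _ _ _ (Ne.symm (hs a))
  ext x
  have : x = (x - X.pr i x) + X.pr i x := by abel
  rw [this, map_add, map_add, key2, key]
  rw [map_sub, hX.idem, sub_self]

theorem reflMap_surj (hG : Good s t i X) (g : (refl X hX hs).E →ₗ[k] (refl Y hY hs).E)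
    (hg : IsHom _ _ g) : ∃ (f : X.E →ₗ[k] Y.E) (hf : IsHom X Y f), reflMap hX hY hs f hf = g := by
  obtain ⟨σ, h1, h2, h3⟩ := hG
  -- first component of g on the complement
  let ι : X.E →ₗ[k] (refl X hX hs).E := LinearMap.codRestrict (reflSub s t i X)
    (LinearMap.inl k X.E (A → X.E) ∘ₗ (LinearMap.id - X.pr i)) (fun x => by
      refine inl_mem ?_
      simp [hX.idem])
  let g1 : X.E →ₗ[k] Y.E := LinearMap.fst k _ _ ∘ₗ rv hY hs ∘ₗ g ∘ₗ ι
  have hι : ∀ x, rv hX hs (ι x) = (x - X.pr i x, 0) := fun x => rfl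
  have hg1 : ∀ x, g1 x = (rv hY hs (g (ι x))).1 := fun x => rfl
  have hιi : ∀ x, ι (X.pr i x) = 0 := by
    intro x; apply rv_inj; rw [hι, hX.idem, sub_self]; rfl
  have hg1i : ∀ x, g1 (X.pr i x) = 0 := by
    intro x; rw [hg1, hιi, map_zero]; rfl
  have hιpr : ∀ v x, v ≠ i → ι (X.pr v x) = (refl X hX hs).pr v (ι x) := by
    intro v x hv
    apply rv_inj
    rw [refl_pr_ne _ _ _ hv, hι, hι]
    simp [hX.orth _ _ _ hv, hX.orth _ _ _ (Ne.symm hv)]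
  have hιT : ∀ a x, t a ≠ i → ι (X.T a x) = (refl X hX hs).T a (ι x) := by
    intro a x ha
    apply rv_inj
    rw [refl_T_ne _ _ _ ha, hι, hι, pr_T_ne hX a ha]
    have : X.T a (X.pr i x) = 0 := by
      rw [← hX.src, hX.orth _ _ _ (hs a), map_zero]
    simp [this]
  have hg1pr : ∀ v x, v ≠ i → g1 (X.pr v x) = Y.pr v (g1 x) := by
    intro v x hv
    rw [hg1, hιpr v x hv, hg.1, hg1]
    exact congrArg Prod.fst (refl_pr_ne hY hs v hv (g (ι x)))
  have hg1T : ∀ a x, t a ≠ i → g1 (X.T a x) = Y.T a (g1 x) := by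
    intro a x ha
    rw [hg1, hιT a x ha, hg.2, hg1]
    exact congrArg Prod.fst (refl_T_ne hY hs a ha (g (ι x)))
  have hg1Y : ∀ x, Y.pr i (g1 x) = 0 := fun x => (rv_mem hY hs (g (ι x))).1
  have hg2 : ∀ (p : (refl X hX hs).E) a, t a = i → g1 ((rv hX hs p).2 a) = (rv hY hs (g p)).2 a := by
    intro p a ha
    have e : ι ((rv hX hs p).2 a) = (refl X hX hs).T a p := by
      apply rv_inj
      rw [refl_T_eq _ _ _ ha, hι]
      have : X.pr i ((rv hX hs p).2 a) = 0 := by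
        rw [← (rv_mem hX hs p).2.2.1 a]; exact hX.orth _ _ _ (Ne.symm (hs a))
      rw [this, sub_zero]
    rw [hg1, e, hg.2]
    exact congrArg Prod.fst (refl_T_eq hY hs a ha (g p))
  -- well-definedness
  have wd : ∀ y : A → X.E, (∀ a, t a ≠ i → y a = 0) → (∀ a, X.pr (s a) (y a) = y a) →
      ∑ a, X.T a (y a) = 0 → ∑ a, Y.T a (g1 (y a)) = 0 := by
    intro y y1 y2 y3
    let p : (refl X hX hs).E := rmk hX hs (0, y) (by rw [mem_reflSub]; exact ⟨by simp, y1, y2, y3⟩)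
    rw [← (rv_mem hY hs (g p)).2.2.2]
    refine Finset.sum_congr rfl fun a _ => ?_
    by_cases ha : t a = i
    · rw [← hg2 p a ha]; rfl
    · rw [y1 a ha, (rv_mem hY hs (g p)).2.1 a ha, map_zero]
  let f : X.E →ₗ[k] Y.E := g1 + ∑ a, Y.T a ∘ₗ g1 ∘ₗ LinearMap.proj a ∘ₗ σ
  have hf : ∀ x, f x = g1 x + ∑ a, Y.T a (g1 (σ x a)) := by
    intro x; simp [f]
  have hf0 : ∀ x, X.pr i x = 0 → f x = g1 x := by
    intro x hx
    rw [hf, wd (σ x) (h1 x) (h2 x) (by rw [h3, hx]), add_zero]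
  have hfi : ∀ y : A → X.E, (∀ a, t a ≠ i → y a = 0) → (∀ a, X.pr (s a) (y a) = y a) →
      f (∑ a, X.T a (y a)) = ∑ a, Y.T a (g1 (y a)) := by
    intro y y1 y2
    have e : X.pr i (∑ a, X.T a (y a)) = ∑ a, X.T a (y a) := by
      rw [map_sum]
      refine Finset.sum_congr rfl fun a _ => ?_
      by_cases ha : t a = i
      · rw [← ha, hX.tgt]
      · rw [y1 a ha, map_zero, map_zero]
    rw [hf]
    have e1 : g1 (∑ a, X.T a (y a)) = 0 := by rw [← e, hg1i]
    rw [e1, zero_add, ← sub_eq_zero, ← Finset.sum_sub_distrib]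
    simp only [← map_sub]
    apply wd (fun a => σ (∑ a, X.T a (y a)) a - y a)
    · intro a ha; rw [h1 _ _ ha, y1 a ha, sub_zero]
    · intro a; rw [map_sub, h2, y2]
    · simp only [map_sub, Finset.sum_sub_distrib]
      rw [h3, e, sub_self]
  have hfpri : ∀ x, f (X.pr i x) = ∑ a, Y.T a (g1 (σ x a)) := by
    intro x; rw [← h3, hfi _ (h1 x) (h2 x)]
  have hfpr : ∀ v x, f (X.pr v x) = Y.pr v (f x) := by
    intro v x
    have hYi : ∀ w, Y.pr w (∑ a, Y.T a (g1 (σ x a))) =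
        if w = i then ∑ a, Y.T a (g1 (σ x a)) else 0 := by
      intro w
      rw [map_sum]
      split_ifs with hw
      · refine Finset.sum_congr rfl fun a _ => ?_
        by_cases ha : t a = i
        · rw [hw, ← ha, hY.tgt]
        · rw [h1 _ _ ha]; simp
      · refine Finset.sum_eq_zero fun a _ => ?_
        by_cases ha : t a = i
        · rw [← hY.tgt, hY.orth]; rw [ha]; exact hw
        · rw [h1 _ _ ha]; simp
    rw [hf x, map_add, hYi]
    by_cases hv : v = i
    · subst hv; rw [hfpri, hg1Y, zero_add, if_pos rfl]
    · rw [hf0 _ (hX.orth _ _ _ (Ne.symm hv)), hg1pr v x hv, if_neg hv, add_zero]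
  have hfT : ∀ a x, f (X.T a x) = Y.T a (f x) := by
    classical
    intro a x
    have hs0 : X.pr i (X.pr (s a) x) = 0 := hX.orth _ _ _ (Ne.symm (hs a))
    have e2 : Y.T a (f x) = Y.T a (g1 (X.pr (s a) x)) := by
      rw [← hf0 _ hs0, hfpr, hY.src]
    rw [e2]
    by_cases ha : t a = i
    · have := hfi (Pi.single a (X.pr (s a) x)) (by
        intro b hb
        rw [Pi.single_eq_of_ne]; rintro rfl; exact hb ha) (by
        intro b
        by_cases hb : b = a
        · subst hb; simp [hX.idem]
        · simp [Pi.single_eq_of_ne hb])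
      rw [Finset.sum_eq_single a, Finset.sum_eq_single a] at this
      · simpa [hX.src] using this
      · intro b _ hb; simp [Pi.single_eq_of_ne hb]
      · simp
      · intro b _ hb; simp [Pi.single_eq_of_ne hb]
      · simp
    · rw [← hX.src, hf0 _ (pr_T_ne hX a ha _), hg1T a _ ha]
  have hfh : IsHom X Y f := ⟨hfpr, hfT⟩
  refine ⟨f, hfh, ?_⟩
  ext p
  apply rv_inj
  rw [reflMap_val]
  have hy : ∀ a, f ((rv hX hs p).2 a) = (rv hY hs (g p)).2 a := by
    intro a
    by_cases ha : t a = i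
    · rw [hf0, hg2 p a ha]
      rw [← (rv_mem hX hs p).2.2.1 a]; exact hX.orth _ _ _ (Ne.symm (hs a))
    · rw [(rv_mem hX hs p).2.1 a ha, (rv_mem hY hs (g p)).2.1 a ha, map_zero]
  refine Prod.ext ?_ (funext hy)
  change f (rv hX hs p).1 = (rv hY hs (g p)).1
  rw [hf0 _ (rv_mem hX hs p).1]
  have e3 : ∀ v, v ≠ i → Y.pr v (g1 (rv hX hs p).1) = Y.pr v (rv hY hs (g p)).1 := by
    intro v hv
    have e4 : ι (X.pr v (rv hX hs p).1) = (refl X hX hs).pr v p := by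
      apply rv_inj
      rw [refl_pr_ne _ _ _ hv, hι, hX.orth _ _ _ (Ne.symm hv), sub_zero]
    rw [← hg1pr v _ hv, hg1, e4, hg.1]
    exact congrArg Prod.fst (refl_pr_ne hY hs v hv (g p))
  rw [← hY.sum (g1 (rv hX hs p).1), ← hY.sum (rv hY hs (g p)).1]
  refine Finset.sum_congr rfl fun v _ => ?_
  by_cases hv : v = i
  · subst hv; rw [hg1Y]; exact (rv_mem hY hs (g p)).1.symm
  · exact e3 v hv

theorem reflMap_isHom (f : X.E →ₗ[k] Y.E) (hf : IsHom X Y f) :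
    IsHom (refl X hX hs) (refl Y hY hs) (reflMap hX hY hs f hf) := by
  constructor
  · intro v p
    apply rv_inj
    rw [reflMap_val]
    by_cases h : v = i
    · subst h; rw [refl_pr_self, refl_pr_self, reflMap_val]; simp
    · rw [refl_pr_ne _ _ _ h, refl_pr_ne _ _ _ h, reflMap_val, ← hf.1]; simp; rfl
  · intro a p
    apply rv_inj
    rw [reflMap_val]
    by_cases h : t a = i
    · rw [refl_T_eq _ _ _ h, refl_T_eq _ _ _ h, reflMap_val]; simp; rfl
    · rw [refl_T_ne _ _ _ h, refl_T_ne _ _ _ h, reflMap_val, ← hf.2]; simp; rfl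

theorem refl_dim_ne (v : V) (h : v ≠ i) : dim (refl X hX hs) v = dim X v := by
  let ι : LinearMap.range (X.pr v) →ₗ[k] (refl X hX hs).E :=
    LinearMap.codRestrict (reflSub s t i X)
      (LinearMap.inl k X.E (A → X.E) ∘ₗ (LinearMap.range (X.pr v)).subtype) (by
        rintro ⟨_, x, rfl⟩
        exact inl_mem (hX.orth _ _ _ (Ne.symm h)))
  have hι : ∀ x, rv hX hs (ι x) = (x.1, 0) := fun x => rfl
  have hinj : Function.Injective ι := by
    intro x y hxy
    have := congrArg (fun p => (rv hX hs p).1) hxy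
    simp only [hι] at this
    exact Subtype.ext this
  have hr : LinearMap.range ι = LinearMap.range ((refl X hX hs).pr v) := by
    ext p
    constructor
    · rintro ⟨⟨_, x, rfl⟩, rfl⟩
      refine ⟨ι ⟨_, x, rfl⟩, ?_⟩
      apply rv_inj
      rw [refl_pr_ne _ _ _ h, hι]
      simp [hX.idem]
    · rintro ⟨q, rfl⟩
      refine ⟨⟨_, (rv hX hs q).1, rfl⟩, ?_⟩
      apply rv_inj
      rw [refl_pr_ne _ _ _ h, hι]
  have := LinearMap.finrank_range_of_inj hinj
  rw [hr] at this
  unfold dim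
  rw [this]

theorem refl_dim_self (hG : Good s t i X) :
    dim (refl X hX hs) i = ∑ a with t a = i, dim X (s a) - dim X i := by
  classical
  have := hX.fin
  let W := ∀ a : {a : A // t a = i}, LinearMap.range (X.pr (s a.1))
  let ex : W →ₗ[k] (A → X.E) := LinearMap.pi fun a =>
    if h : t a = i then (LinearMap.range (X.pr (s a))).subtype ∘ₗ
      LinearMap.proj (R := k) (φ := fun a : {a : A // t a = i} => LinearMap.range (X.pr (s a.1))) ⟨a, h⟩
    else 0
  have hex : ∀ (w : W) a (h : t a = i), ex w a = (w ⟨a, h⟩).1 := by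
    intro w a h; simp [ex, h]; rfl
  have hex0 : ∀ (w : W) a (h : t a ≠ i), ex w a = 0 := by
    intro w a h; simp [ex, h]
  have hexpr : ∀ (w : W) a, X.pr (s a) (ex w a) = ex w a := by
    intro w a
    by_cases h : t a = i
    · rw [hex w a h]; obtain ⟨x, hx⟩ := (w ⟨a, h⟩).2
      rw [← hx, hX.idem]
    · rw [hex0 w a h, map_zero]
  have hcol : ∀ (y : A → X.E), (∀ a, t a ≠ i → y a = 0) → (∀ a, X.pr (s a) (y a) = y a) →
      ∃ w : W, ex w = y := by
    intro y y1 y2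
    refine ⟨fun a => ⟨y a.1, y a.1, y2 a.1⟩, ?_⟩
    funext a
    by_cases h : t a = i
    · rw [hex _ _ h]
    · rw [hex0 _ _ h, y1 a h]
  let sm : W →ₗ[k] X.E := ∑ a, X.T a ∘ₗ LinearMap.proj a ∘ₗ ex
  have hsm : ∀ w, sm w = ∑ a, X.T a (ex w a) := by intro w; simp [sm]
  have hrange : LinearMap.range sm = LinearMap.range (X.pr i) := by
    obtain ⟨σ, h1, h2, h3⟩ := hG
    ext x; constructor
    · rintro ⟨w, rfl⟩
      refine ⟨sm w, ?_⟩
      rw [hsm, map_sum]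
      refine Finset.sum_congr rfl fun a _ => ?_
      by_cases ha : t a = i
      · have := hX.tgt a (ex w a)
        rwa [ha] at this
      · rw [hex0 w a ha, map_zero, map_zero]
    · rintro ⟨y, rfl⟩
      obtain ⟨w, hw⟩ := hcol (σ y) (h1 y) (h2 y)
      exact ⟨w, by rw [hsm, hw, h3]⟩
  let κ : LinearMap.ker sm →ₗ[k] (refl X hX hs).E :=
    LinearMap.codRestrict (reflSub s t i X)
      (LinearMap.inr k X.E (A → X.E) ∘ₗ ex ∘ₗ (LinearMap.ker sm).subtype) (by
        rintro ⟨w, hw⟩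
        rw [mem_reflSub]
        refine ⟨by simp, fun a ha => hex0 w a ha, fun a => hexpr w a, ?_⟩
        rw [LinearMap.mem_ker, hsm] at hw
        exact hw)
  have hκ : ∀ w, rv hX hs (κ w) = (0, ex w.1) := fun w => rfl
  have hinj : Function.Injective κ := by
    intro x y hxy
    have := congrArg (fun p => (rv hX hs p).2) hxy
    simp only [hκ] at this
    apply Subtype.ext
    funext a
    apply Subtype.ext
    rw [← hex _ _ a.2, ← hex _ _ a.2, this]
  have hr : LinearMap.range κ = LinearMap.range ((refl X hX hs).pr i) := by
    ext p
    constructor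
    · rintro ⟨w, rfl⟩
      refine ⟨κ w, ?_⟩
      apply rv_inj
      rw [refl_pr_self, hκ]
    · rintro ⟨q, rfl⟩
      have hq := rv_mem hX hs q
      obtain ⟨w, hw⟩ := hcol _ hq.2.1 hq.2.2.1
      refine ⟨⟨w, ?_⟩, ?_⟩
      · rw [LinearMap.mem_ker, hsm, hw]; exact hq.2.2.2
      · apply rv_inj
        rw [refl_pr_self, hκ, hw]
  have e1 := LinearMap.finrank_range_of_inj hinj
  rw [hr] at e1
  have e2 := LinearMap.finrank_range_add_finrank_ker sm
  rw [hrange] at e2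
  have e3 : Module.finrank k W = ∑ a : {a : A // t a = i},
      Module.finrank k (LinearMap.range (X.pr (s a.1))) := Module.finrank_pi_fintype k
  have e4 : ∑ a with t a = i, dim X (s a) = (Module.finrank k W : ℤ) := by
    rw [e3, Nat.cast_sum, Finset.sum_subtype (p := fun a => t a = i) _ (by simp)]
    rfl
  rw [e4, ← e2]
  unfold dim
  rw [e1]
  push_cast
  ring

theorem good_or (hX : IsRep s t X) (hs : ∀ a, s a ≠ i) (hI : Ind X) : Good s t i X ∨ dim X = Pi.single i 1 := by
  classical
  have hfin := hX.fin
  let sm : (A → X.E) →ₗ[k] X.E :=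
    ∑ a, (if t a = i then X.T a else 0) ∘ₗ LinearMap.proj a
  have hsm : ∀ y, sm y = ∑ a, if t a = i then X.T a (y a) else 0 := by
    intro y; simp only [sm, LinearMap.sum_apply, LinearMap.comp_apply, LinearMap.proj_apply]
    refine Finset.sum_congr rfl fun a _ => ?_
    split_ifs <;> rfl
  have hTi : ∀ a x, t a = i → X.pr i (X.T a x) = X.T a x := by
    intro a x ha
    have := hX.tgt a x
    rwa [ha] at this
  have hsmi : ∀ y, X.pr i (sm y) = sm y := by
    intro y
    rw [hsm, map_sum]
    refine Finset.sum_congr rfl fun a _ => ?_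
    split_ifs with ha
    · exact hTi a _ ha
    · exact map_zero _
  obtain ⟨C, hC⟩ := Submodule.exists_isCompl (LinearMap.range sm)
  let e0 : X.E →ₗ[k] X.E := C.projection (LinearMap.range sm) hC.symm
  have he0U : ∀ y, e0 (sm y) = 0 := by
    intro y
    exact (Submodule.projection_apply_eq_zero_iff hC.symm).2 ⟨y, rfl⟩
  have he0i : ∀ x, x - e0 x ∈ LinearMap.range sm := by
    intro x
    exact Submodule.sub_projection_mem hC.symm x
  have he00 : ∀ x, e0 (e0 x) = e0 x := by
    intro x
    obtain ⟨y, hy⟩ := he0i x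
    have := he0U y
    rw [hy, map_sub, sub_eq_zero] at this
    exact this.symm
  have hpe : ∀ x, X.pr i (e0 (X.pr i x)) = e0 (X.pr i x) := by
    intro x
    obtain ⟨y, hy⟩ := he0i (X.pr i x)
    have h := hsmi y
    rw [hy, map_sub, hX.idem] at h
    exact (sub_right_inj.mp h)
  have hpv : ∀ v x, v ≠ i → X.pr v (e0 (X.pr i x)) = 0 := by
    intro v x hv
    rw [← hpe, hX.orth _ _ _ hv]
  have hTe : ∀ a x, e0 (X.pr i (X.T a x)) = 0 := by
    intro a x
    by_cases ha : t a = i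
    · have : sm (Pi.single a x) = X.T a x := by
        rw [hsm, Finset.sum_eq_single a]
        · simp [ha]
        · intro b _ hb; simp [Pi.single_eq_of_ne hb]
        · simp
      rw [hTi _ _ ha, ← this, he0U]
    · rw [pr_T_ne hX a ha, map_zero]
  have hIe := hI.2 (e0 ∘ₗ X.pr i) ⟨by
      intro v x
      simp only [LinearMap.comp_apply]
      by_cases hv : v = i
      · subst hv; rw [hX.idem, hpe]
      · rw [hX.orth _ _ _ (Ne.symm hv), map_zero, hpv _ _ hv], by
      intro a x
      simp only [LinearMap.comp_apply]
      rw [hTe, ← hX.src, hpv _ _ (hs a), map_zero]⟩ (by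
      ext x
      simp only [LinearMap.comp_apply]
      rw [hpe, he00])
  rcases hIe with h0 | h1
  · left
    obtain ⟨r, hr⟩ := LinearMap.exists_rightInverse_of_surjective sm.rangeRestrict
      (LinearMap.range_rangeRestrict sm)
    have hmem : ∀ x, X.pr i x ∈ LinearMap.range sm := by
      intro x
      have h2 := he0i (X.pr i x)
      have h3 : e0 (X.pr i x) = 0 := congrArg (fun f => f x) h0
      rwa [h3, sub_zero] at h2
    let σ0 : X.E →ₗ[k] (A → X.E) := r ∘ₗ LinearMap.codRestrict _ (X.pr i) hmem
    have hσ0 : ∀ x, sm (σ0 x) = X.pr i x := by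
      intro x
      have h4 := congrArg (fun f => (f (LinearMap.codRestrict _ (X.pr i) hmem x)).1) hr
      exact h4
    let σ : X.E →ₗ[k] (A → X.E) := LinearMap.pi fun a =>
      (if t a = i then X.pr (s a) else 0) ∘ₗ LinearMap.proj a ∘ₗ σ0
    have hσ : ∀ x a, σ x a = if t a = i then X.pr (s a) (σ0 x a) else 0 := by
      intro x a
      simp only [σ, LinearMap.pi_apply, LinearMap.comp_apply, LinearMap.proj_apply]
      split_ifs <;> rfl
    refine ⟨σ, ?_, ?_, ?_⟩
    · intro x a ha; rw [hσ, if_neg ha]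
    · intro x a; rw [hσ]; split_ifs
      · rw [hX.idem]
      · rw [map_zero]
    · intro x
      rw [← hσ0, hsm]
      refine Finset.sum_congr rfl fun a _ => ?_
      rw [hσ]; split_ifs
      · rw [hX.src]
      · rw [map_zero]
  · right
    have h1' : ∀ x, e0 (X.pr i x) = x := fun x => congrArg (fun f => f x) h1
    have hid : ∀ x, X.pr i x = x := by
      intro x
      have := hpe x
      rwa [h1' x] at this
    have hT0 : ∀ a x, X.T a x = 0 := by
      intro a x
      rw [← h1' (X.T a x), hTe]
    have hv0 : ∀ v x, v ≠ i → X.pr v x = 0 := by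
      intro v x hv
      rw [← hid x, hX.orth _ _ _ hv]
    obtain ⟨x0, hx0⟩ := hI.1
    obtain ⟨D, hD⟩ := Submodule.exists_isCompl (Submodule.span k {x0})
    have hx0m : x0 ∈ Submodule.span k {x0} := Submodule.mem_span_singleton_self x0
    have hp := hI.2 ((Submodule.span k {x0}).projection D hD) ⟨by
      intro v x
      by_cases hv : v = i
      · subst hv; rw [hid, hid]
      · rw [hv0 _ _ hv, hv0 _ _ hv, map_zero], by
      intro a x; rw [hT0, hT0, map_zero]⟩ (Submodule.isIdempotentElem_projection hD)
    have hfr : Module.finrank k X.E = 1 := by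
      rcases hp with hp | hp
      · exfalso; apply hx0
        have h5 := Submodule.projection_apply_left hD ⟨x0, hx0m⟩
        rw [hp] at h5
        exact h5.symm
      · have h6 := Submodule.range_projection hD
        rw [hp, LinearMap.range_id] at h6
        rw [← finrank_top, h6, finrank_span_singleton hx0]
    funext v
    unfold dim
    by_cases hv : v = i
    · subst hv
      have : X.pr v = LinearMap.id := LinearMap.ext hid
      rw [this, LinearMap.range_id, finrank_top, hfr]; simp
    · have : X.pr v = 0 := LinearMap.ext fun x => hv0 v x hv
      rw [this, LinearMap.range_zero, finrank_bot, Pi.single_eq_of_ne hv]; simp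

theorem refl_ind (hG : Good s t i X) (hI : Ind X) : Ind (refl X hX hs) := by
  constructor
  · by_contra hcon
    push Not at hcon
    obtain ⟨x, hx⟩ := hI.1
    apply hx
    have h0 : ∀ x, X.pr i x = 0 → x = 0 := by
      intro x hx
      exact congrArg (fun p => (rv hX hs p).1) (hcon (rmk hX hs (x, 0) (inl_mem hx)))
    have h1 : ∀ a x, X.T a x = 0 := by
      intro a x
      rw [← hX.src, h0 _ (hX.orth _ _ _ (Ne.symm (hs a))), map_zero]
    obtain ⟨σ, _, _, h3⟩ := hG
    apply h0
    rw [← h3]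
    simp [h1]
  · intro g hg hgg
    obtain ⟨f, hf, rfl⟩ := reflMap_surj hX hX hs hG g hg
    have hff : IsHom X X (f ∘ₗ f) := ⟨fun v x => by simp [hf.1], fun a x => by simp [hf.2]⟩
    have h0 : IsHom X X (0 : X.E →ₗ[k] X.E) := ⟨fun v x => by simp, fun a x => by simp⟩
    have h1 : IsHom X X (LinearMap.id : X.E →ₗ[k] X.E) := ⟨fun v x => by simp, fun a x => by simp⟩
    have := reflMap_inj hX hX hs hG (f ∘ₗ f) f hff hf (by
      intro p
      have h2 := congrArg (fun F => F p) hgg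
      exact h2)
    rcases hI.2 f hf this with h | h
    · left; subst h; rfl
    · right; subst h; rfl

/-- one reflection step -/
theorem claim_step (hs : ∀ a, s a ≠ i) (s' t' : A → V) (h1 : ∀ a, t a = i → s' a = i ∧ t' a = s a)
    (h2 : ∀ a, t a ≠ i → s' a = s a ∧ t' a = t a) (x x' : V → ℤ)
    (hx : ∀ v, v ≠ i → x' v = x v) (hxi : x' i = ∑ a with t a = i, x (s a) - x i)
    (hC : Claim k s' t' x') : Claim k s t x := by
  intro X hX hI hdX
  by_cases hxe : x = Pi.single i 1
  · have key : ∀ Z : TRep k V A, IsRep s t Z → dim Z = x →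
        Module.finrank k Z.E = 1 ∧ (∀ z, Z.pr i z = z) ∧ (∀ v z, v ≠ i → Z.pr v z = 0) ∧
        (∀ a z, Z.T a z = 0) := by
      intro Z hZ hdZ
      have := hZ.fin
      have hv : ∀ v z, v ≠ i → Z.pr v z = 0 := by
        intro v z hv
        have h3 := congrFun hdZ v
        rw [hxe, Pi.single_eq_of_ne hv] at h3
        unfold dim at h3
        have h4 : LinearMap.range (Z.pr v) = ⊥ := by
          apply Submodule.finrank_eq_zero.mp
          exact_mod_cast h3
        have h5 : Z.pr v z ∈ LinearMap.range (Z.pr v) := ⟨z, rfl⟩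
        rw [h4] at h5
        exact (Submodule.mem_bot k).mp h5
      have hi : ∀ z, Z.pr i z = z := by
        intro z
        conv_rhs => rw [← hZ.sum z]
        rw [Finset.sum_eq_single i]
        · intro v _ h; exact hv v z h
        · simp
      refine ⟨?_, hi, hv, ?_⟩
      · have h3 := congrFun hdZ i
        rw [hxe, Pi.single_eq_same] at h3
        unfold dim at h3
        have : Z.pr i = LinearMap.id := LinearMap.ext hi
        rw [this, LinearMap.range_id, finrank_top] at h3
        exact_mod_cast h3
      · intro a z
        rw [← hZ.src, hv _ _ (hs a), map_zero]
    obtain ⟨kX1, kX2, kX3, kX4⟩ := key X hX hdX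
    constructor
    · intro f hf
      obtain ⟨b, hb, hb'⟩ := finrank_eq_one_iff'.mp kX1
      obtain ⟨c, hc⟩ := hb' (f b)
      refine ⟨c, fun y => ?_⟩
      obtain ⟨d, rfl⟩ := hb' y
      rw [map_smul, ← hc, smul_comm]
    · intro Y hY hIY hdY
      obtain ⟨kY1, kY2, kY3, kY4⟩ := key Y hY hdY
      have := hX.fin
      have := hY.fin
      let φ := LinearEquiv.ofFinrankEq X.E Y.E (kX1.trans kY1.symm)
      have hh : ∀ (Z Z' : TRep k V A) (f : Z.E →ₗ[k] Z'.E), (∀ z, Z.pr i z = z) →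
          (∀ v z, v ≠ i → Z.pr v z = 0) → (∀ a z, Z.T a z = 0) → (∀ z, Z'.pr i z = z) →
          (∀ v z, v ≠ i → Z'.pr v z = 0) → (∀ a z, Z'.T a z = 0) → IsHom Z Z' f := by
        intro Z Z' f a1 a2 a3 b1 b2 b3
        refine ⟨fun v z => ?_, fun a z => by rw [a3, b3, map_zero]⟩
        by_cases hv : v = i
        · subst hv; rw [a1, b1]
        · rw [a2 _ _ hv, b2 _ _ hv, map_zero]
      exact ⟨φ.toLinearMap, φ.symm.toLinearMap, hh _ _ _ kX2 kX3 kX4 kY2 kY3 kY4,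
        hh _ _ _ kY2 kY3 kY4 kX2 kX3 kX4, fun z => by simp, fun z => by simp⟩
  · have hgood : ∀ Z : TRep k V A, IsRep s t Z → Ind Z → dim Z = x → Good s t i Z := by
      intro Z hZ hIZ hdZ
      rcases good_or hZ hs hIZ with h | h
      · exact h
      · exact absurd (hdZ.symm.trans h) hxe
    have hdim : ∀ (Z : TRep k V A) (hZ : IsRep s t Z), Ind Z → dim Z = x →
        dim (refl Z hZ hs) = x' := by
      intro Z hZ hIZ hdZ
      funext v
      by_cases hv : v = i
      · subst hv; rw [refl_dim_self hZ hs (hgood Z hZ hIZ hdZ), hxi, hdZ]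
      · rw [refl_dim_ne hZ hs v hv, hdZ, hx v hv]
    have hGX := hgood X hX hI hdX
    obtain ⟨c1, c2⟩ := hC (refl X hX hs) (refl_isRep hX hs s' t' h1 h2) (refl_ind hX hs hGX hI)
      (hdim X hX hI hdX)
    constructor
    · intro f hf
      obtain ⟨c, hc⟩ := c1 _ (reflMap_isHom hX hX hs f hf)
      have hcH : IsHom X X (c • LinearMap.id) := ⟨fun v x => by simp, fun a x => by simp⟩
      have := reflMap_inj hX hX hs hGX f _ hf hcH (by
        intro p
        rw [hc]; rfl)
      exact ⟨c, fun y => by rw [this]; rfl⟩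
    · intro Y hY hIY hdY
      have hGY := hgood Y hY hIY hdY
      obtain ⟨F, G, hF, hG, hGF, hFG⟩ := c2 (refl Y hY hs) (refl_isRep hY hs s' t' h1 h2)
        (refl_ind hY hs hGY hIY) (hdim Y hY hIY hdY)
      obtain ⟨f, hf, rfl⟩ := reflMap_surj hX hY hs hGX F hF
      obtain ⟨g, hg, rfl⟩ := reflMap_surj hY hX hs hGY G hG
      have hid : ∀ Z : TRep k V A, IsHom Z Z (LinearMap.id : Z.E →ₗ[k] Z.E) :=
        fun Z => ⟨fun v x => by simp, fun a x => by simp⟩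
      have hgf : IsHom X X (g ∘ₗ f) :=
        ⟨fun v x => by simp [hf.1, hg.1], fun a x => by simp [hf.2, hg.2]⟩
      have hfg : IsHom Y Y (f ∘ₗ g) :=
        ⟨fun v x => by simp [hf.1, hg.1], fun a x => by simp [hf.2, hg.2]⟩
      have e1 := reflMap_inj hX hX hs hGX _ _ hgf (hid X) (fun p => hGF p)
      have e2 := reflMap_inj hY hY hs hGY _ _ hfg (hid Y) (fun p => hFG p)
      exact ⟨f, g, hf, hg, fun y => congrArg (fun F => F y) e1, fun y => congrArg (fun F => F y) e2⟩

end
end TRep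


set_option linter.unusedSectionVars false

namespace TRep

variable {k V A : Type} [Field k] [Fintype V] [DecidableEq V] [Fintype A]

theorem claim_cox (s t : A → V)
    (hac : ∀ D : Finset V, D.Nonempty → ∃ i ∈ D, ∀ a, s a = i → t a ∉ D)
    (x x' : V → ℤ)
    (hxx : ∀ j, x' j - ∑ a with s a = j, x' (t a) = -(x j - ∑ a with t a = j, x (s a)))
    (hC : Claim k s t x') : Claim k s t x := by
  classical
  have main : ∀ n, ∀ S : Finset V, (∀ a, s a ∈ S → t a ∈ S) → Sᶜ.card = n →
      Claim k (fun a => if t a ∈ S ∧ s a ∉ S then t a else s a)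
        (fun a => if t a ∈ S ∧ s a ∉ S then s a else t a)
        (fun v => if v ∈ S then x' v else x v) := by
    intro n
    induction n with
    | zero =>
      intro S hS h0
      have hu : ∀ v, v ∈ S := by
        intro v
        by_contra hv
        rw [Finset.card_eq_zero] at h0
        have : v ∈ Sᶜ := by simpa using hv
        rw [h0] at this
        simp at this
      simpa [hu] using hC
    | succ n ih =>
      intro S hS hn
      obtain ⟨i, hi, hia⟩ := hac Sᶜ (Finset.card_pos.mp (by omega))
      have hiS : i ∉ S := by simpa using hi
      have hia' : ∀ a, s a = i → t a ∈ S := fun a ha => by simpa using hia a ha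
      have hS' : ∀ a, s a ∈ insert i S → t a ∈ insert i S := by
        intro a ha
        rw [Finset.mem_insert] at ha ⊢
        rcases ha with ha | ha
        · exact Or.inr (hia' a ha)
        · exact Or.inr (hS a ha)
      have hcard : (insert i S)ᶜ.card = n := by
        rw [Finset.card_compl] at hn ⊢
        rw [Finset.card_insert_of_notMem hiS]
        omega
      have hCi := ih _ hS' hcard
      refine claim_step (i := i) ?_ _ _ ?_ ?_ _ _ ?_ ?_ hCi
      · intro a
        by_cases hf : t a ∈ S ∧ s a ∉ S
        · simp only [hf, not_false_eq_true, and_self, if_true]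
          rintro h; exact hiS (h ▸ hf.1)
        · simp only [hf, if_false]
          intro h
          exact hf ⟨hia' a h, h ▸ hiS⟩
      · intro a
        have h1 := hS a
        have h2 := hia' a
        by_cases hf : t a ∈ S ∧ s a ∉ S
        · simp only [if_pos hf]
          intro h
          have : ¬ (t a ∈ insert i S ∧ s a ∉ insert i S) := by
            rw [h]; simp
          simp only [if_neg this]
          exact ⟨h, trivial⟩
        · simp only [if_neg hf]
          intro h
          have hsa : s a ∉ S := fun hh => hiS (h ▸ h1 hh)
          have hsi : s a ≠ i := fun hh => hiS (h ▸ h2 hh)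
          have : (t a ∈ insert i S ∧ s a ∉ insert i S) := by
            simp [h, hsa, hsi]
          simp only [if_pos this]
          exact ⟨h, trivial⟩
      · intro a
        by_cases hf : t a ∈ S ∧ s a ∉ S
        · simp only [if_pos hf]
          intro h
          have : (t a ∈ insert i S ∧ s a ∉ insert i S) := by
            simp [h, hf.1, hf.2]
          simp only [if_pos this]
          simp
        · simp only [if_neg hf]
          intro h
          have : ¬ (t a ∈ insert i S ∧ s a ∉ insert i S) := by
            simp only [Finset.mem_insert, h, false_or, not_or, not_and, not_not]
            intro h3 h4
            by_contra h5
            exact hf ⟨h3, h5⟩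
          simp only [if_neg this]
          simp
      · intro v hv
        simp [hv]
      · simp only [Finset.mem_insert, true_or, if_true, if_neg hiS]
        have h := hxx i
        have key : ∑ a with (if t a ∈ S ∧ s a ∉ S then s a else t a) = i,
            (if (if t a ∈ S ∧ s a ∉ S then t a else s a) ∈ S then
              x' (if t a ∈ S ∧ s a ∉ S then t a else s a) else
              x (if t a ∈ S ∧ s a ∉ S then t a else s a))
            = ∑ a with s a = i, x' (t a) + ∑ a with t a = i, x (s a) := by
          simp only [Finset.sum_filter]
          rw [← Finset.sum_add_distrib]
          refine Finset.sum_congr rfl fun a _ => ?_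
          by_cases h1 : s a = i
          · have h2 := hia' a h1
            have h3 : t a ≠ i := fun hh => hiS (hh ▸ h2)
            have h4 : s a ∉ S := h1 ▸ hiS
            simp [h1, h2, h3, hiS]
          · by_cases h2 : t a = i
            · have h4 : s a ∉ S := fun hh => hiS (h2 ▸ hS a hh)
              simp [h1, h2, h4, hiS]
            · have : (if t a ∈ S ∧ s a ∉ S then s a else t a) ≠ i := by
                split_ifs <;> assumption
              simp [h1, h2, this]
        rw [key]
        linarith
  have h0 := main _ ∅ (by simp) rfl
  simpa using h0

theorem exists_cox (s t : A → V)
    (hac : ∀ D : Finset V, D.Nonempty → ∃ i ∈ D, ∀ a, s a = i → t a ∉ D) (x : V → ℤ) :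
    ∃ x' : V → ℤ,
      ∀ j, x' j - ∑ a with s a = j, x' (t a) = -(x j - ∑ a with t a = j, x (s a)) := by
  classical
  have wf : WellFounded (fun j i : V => ∃ a, s a = i ∧ t a = j) := by
    rw [WellFounded.wellFounded_iff_has_min]
    intro D hD
    obtain ⟨i, hi, h⟩ := hac D.toFinset (by simpa using hD)
    refine ⟨i, by simpa using hi, ?_⟩
    rintro j hj ⟨a, ha, rfl⟩
    exact h a ha (by simpa using hj)
  let F : ∀ j : V, (∀ i : V, (∃ a, s a = j ∧ t a = i) → ℤ) → ℤ := fun j rec =>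
    -(x j - ∑ a with t a = j, x (s a)) +
      ∑ a, if h : s a = j then rec (t a) ⟨a, h, rfl⟩ else 0
  refine ⟨wf.fix F, fun j => ?_⟩
  rw [wf.fix_eq F j]
  simp only [F, Finset.sum_filter, dite_eq_ite]
  ring

theorem claim_all (s t : A → V) (hp : ∀ y, 0 ≤ QNum.EF s t y y)
    (hc : ∀ u v : V, Relation.ReflTransGen
    (fun x y => ∃ a, (s a = x ∧ t a = y) ∨ (s a = y ∧ t a = x)) u v)
    (hac : ∀ D : Finset V, D.Nonempty → ∃ i ∈ D, ∀ a, s a = i → t a ∉ D)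
    [Nonempty V] (δ : V → ℚ) (hδ : ∀ v, 0 < δ v)
    (hδr : ∀ z, QNum.EF s t δ z + QNum.EF s t z δ = 0)
    (x : V → ℤ) (hx : QNum.EF s t δ (fun v => (x v : ℚ)) < 0) : Claim k s t x := by
  by_contra hcl
  choose c hcx using exists_cox s t hac
  have hn : ∀ n, ¬ Claim k s t (c^[n] x) := by
    intro n
    induction n with
    | zero => exact hcl
    | succ n ih =>
      rw [Function.iterate_succ_apply']
      exact fun h => ih (claim_cox s t hac _ _ (hcx _) h)
  refine QNum.num s t hp hc δ hδ hδr (fun n v => ((c^[n] x v : ℤ) : ℚ)) ?_ ?_ (by simpa using hx)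
  · intro n v
    by_contra hneg
    apply hn n
    intro X hX hI hd
    exfalso
    have h1 : 0 ≤ dim X v := by simp [dim]
    rw [hd] at h1
    exact hneg (by exact_mod_cast h1)
  · intro n y
    have : (QNum.EF s t).flip (fun v => ((c^[n+1] x v : ℤ) : ℚ)) =
        - QNum.EF s t (fun v => ((c^[n] x v : ℤ) : ℚ)) := by
      apply LinearMap.pi_ext
      intro j r
      have h1 : (Pi.single j r : V → ℚ) = r • Pi.single j 1 := by
        rw [← Pi.single_smul]; simp
      rw [h1, map_smul, map_smul]
      congr 1
      simp only [LinearMap.flip_apply, LinearMap.neg_apply, QNum.EF_single_left,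
        QNum.EF_single_right]
      rw [Function.iterate_succ_apply']
      exact_mod_cast hcx (c^[n] x) j
    exact congrArg (fun g : (V → ℚ) →ₗ[ℚ] ℚ => g y) this

end TRep


section Bridge

variable {k : Type} [Field k] {Q : QuiverData}

/-- total space of a representation -/
noncomputable abbrev Repn.toT (N : Repn k Q) : TRep k Q.V Q.A where
  E := ∀ v, N.space v
  pr v := LinearMap.single k N.space v ∘ₗ LinearMap.proj v
  T a := LinearMap.single k N.space (Q.t a) ∘ₗ N.map a ∘ₗ LinearMap.proj (Q.s a)

theorem Repn.toT_pr (N : Repn k Q) (v : Q.V) (x : ∀ v, N.space v) :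
    N.toT.pr v x = (Pi.single v (x v) : ∀ v, N.space v) := rfl

theorem Repn.toT_T (N : Repn k Q) (a : Q.A) (x : ∀ v, N.space v) :
    N.toT.T a x = (Pi.single (Q.t a) (N.map a (x (Q.s a))) : ∀ v, N.space v) := rfl

theorem Repn.toT_isRep (N : Repn k Q) (hN : N.FinDim) : TRep.IsRep Q.s Q.t N.toT where
  idem v x := by rw [toT_pr, toT_pr]; simp
  orth v w x h := by
    rw [toT_pr, toT_pr, Pi.single_eq_of_ne h, Pi.single_zero]
  sum x := by
    simp only
    exact Finset.univ_sum_single (x : ∀ v, N.space v)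
  src a x := by rw [toT_pr, toT_T, toT_T]; simp
  tgt a x := by rw [toT_pr, toT_T]; simp
  fin := by
    have : ∀ v, FiniteDimensional k (N.space v) := hN
    exact inferInstanceAs (FiniteDimensional k (∀ v, N.space v))

theorem Repn.toT_dim (N : Repn k Q) : TRep.dim N.toT = natc N.dimv := by
  funext v
  simp only [TRep.dim, natc, Repn.dimv]
  congr 1
  have h : LinearMap.range (N.toT.pr v) = LinearMap.range (LinearMap.single k N.space v) := by
    refine LinearMap.range_comp_of_range_eq_top _ ?_
    exact LinearMap.range_eq_top.mpr (LinearMap.proj_surjective v)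
  rw [h]
  exact LinearMap.finrank_range_of_inj (Pi.single_injective v)

/-- components of a total map -/
noncomputable def compo (N W : Repn k Q) (f : N.toT.E →ₗ[k] W.toT.E) (v : Q.V) :
    N.space v →ₗ[k] W.space v :=
  LinearMap.proj v ∘ₗ (f : (∀ v, N.space v) →ₗ[k] (∀ v, W.space v)) ∘ₗ
    LinearMap.single k N.space v

theorem compo_apply (N W : Repn k Q) (f : N.toT.E →ₗ[k] W.toT.E) (hf : TRep.IsHom _ _ f) (v : Q.V)
    (x : ∀ v, N.space v) : compo N W f v (x v) = (f x : ∀ v, W.space v) v := by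
  have h := hf.1 v x
  rw [Repn.toT_pr, Repn.toT_pr] at h
  have h2 := congrFun h v
  rw [Pi.single_eq_same] at h2
  exact h2

theorem compo_comm (N W : Repn k Q) (f : N.toT.E →ₗ[k] W.toT.E) (hf : TRep.IsHom _ _ f) (a : Q.A)
    (x : N.space (Q.s a)) :
    compo N W f (Q.t a) (N.map a x) = W.map a (compo N W f (Q.s a) x) := by
  have h := hf.2 a (Pi.single (Q.s a) x : ∀ v, N.space v)
  rw [Repn.toT_T, Repn.toT_T] at h
  have h2 := congrFun h (Q.t a)
  rw [Pi.single_eq_same, Pi.single_eq_same] at h2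
  exact h2

/-- total map of a family -/
noncomputable def totalMap (N W : Repn k Q) (φ : ∀ v, N.space v →ₗ[k] W.space v) :
    N.toT.E →ₗ[k] W.toT.E :=
  (LinearMap.pi fun v => φ v ∘ₗ LinearMap.proj v :
    (∀ v, N.space v) →ₗ[k] (∀ v, W.space v))

theorem totalMap_apply (N W : Repn k Q) (φ : ∀ v, N.space v →ₗ[k] W.space v)
    (x : ∀ v, N.space v) (v : Q.V) : (totalMap N W φ x : ∀ v, W.space v) v = φ v (x v) := rfl

theorem totalMap_isHom (N W : Repn k Q) (φ : ∀ v, N.space v →ₗ[k] W.space v)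
    (h : ∀ a x, φ (Q.t a) (N.map a x) = W.map a (φ (Q.s a) x)) :
    TRep.IsHom _ _ (totalMap N W φ) := by
  constructor
  · intro v x
    rw [Repn.toT_pr, Repn.toT_pr]
    funext w
    rw [totalMap_apply]
    by_cases hw : w = v
    · subst hw
      rw [Pi.single_eq_same, Pi.single_eq_same]; rfl
    · rw [Pi.single_eq_of_ne hw, Pi.single_eq_of_ne hw, map_zero]
  · intro a x
    rw [Repn.toT_T, Repn.toT_T]
    funext w
    rw [totalMap_apply]
    by_cases hw : w = Q.t a
    · subst hw
      rw [Pi.single_eq_same, Pi.single_eq_same, h]; rfl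
    · rw [Pi.single_eq_of_ne hw, Pi.single_eq_of_ne hw, map_zero]

theorem Repn.toT_ind (N : Repn k Q) (hN : N.Indec) : TRep.Ind N.toT := by
  obtain ⟨h0, hind⟩ := hN
  constructor
  · simp only [Repn.IsZero, not_forall] at h0
    obtain ⟨v, x, hx⟩ := h0
    refine ⟨(Pi.single v x : ∀ v, N.space v), fun h => hx ?_⟩
    have := congrFun h v
    rw [Pi.single_eq_same] at this
    exact this
  · intro e he hee
    have hce : ∀ v (x : N.space v), compo N N e v (compo N N e v x) = compo N N e v x := by
      intro v x
      have h1 := compo_apply N N e he v (Pi.single v x)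
      rw [Pi.single_eq_same] at h1
      rw [h1, compo_apply N N e he v]
      exact congrFun (congrArg (fun g : N.toT.E →ₗ[k] N.toT.E => g (Pi.single v x : ∀ v, N.space v)) hee) v
    let Y : Subrep N := ⟨fun v => LinearMap.range (compo N N e v), by
      rintro a _ ⟨_, ⟨x, rfl⟩, rfl⟩
      exact ⟨_, compo_comm N N e he a x⟩⟩
    let Z : Subrep N := ⟨fun v => LinearMap.ker (compo N N e v), by
      rintro a _ ⟨x, hx, rfl⟩
      rw [LinearMap.mem_ker, compo_comm N N e he a x, LinearMap.mem_ker.mp hx, map_zero]⟩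
    have hiso : Nonempty (Repn.Iso N (Y.repn.dsum Z.repn)) := by
      refine ⟨⟨fun v => LinearEquiv.ofLinearMap
        (LinearMap.prod (LinearMap.rangeRestrict (compo N N e v))
          (LinearMap.codRestrict (LinearMap.ker (compo N N e v))
            (LinearMap.id - compo N N e v) (fun x => by
              rw [LinearMap.mem_ker]; simp [hce])))
        (LinearMap.coprod (Submodule.subtype _) (Submodule.subtype _)) ?_ ?_, ?_⟩⟩
      · refine LinearMap.ext ?_
        rintro ⟨⟨_, ⟨y, rfl⟩⟩, ⟨z, hz⟩⟩
        rw [LinearMap.mem_ker] at hz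
        refine Prod.ext (Subtype.ext ?_) (Subtype.ext ?_)
        · change compo N N e v (compo N N e v y + z) = compo N N e v y
          simp [hce, hz]
        · change compo N N e v y + z - compo N N e v (compo N N e v y + z) = z
          simp [hce, hz]
      · refine LinearMap.ext fun x => ?_
        change compo N N e v x + (x - compo N N e v x) = x
        simp
      · intro a x
        refine Prod.ext (Subtype.ext ?_) (Subtype.ext ?_)
        · exact compo_comm N N e he a x
        · change N.map a x - compo N N e _ (N.map a x) = N.map a (x - compo N N e _ x)
          rw [compo_comm N N e he a x, map_sub]
    rcases hind _ _ hiso with h | h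
    · left
      refine LinearMap.ext fun x => ?_
      funext v
      rw [← compo_apply N N e he v x]
      exact congrArg Subtype.val (h v ⟨_, ⟨x v, rfl⟩⟩)
    · right
      refine LinearMap.ext fun x => ?_
      funext v
      rw [← compo_apply N N e he v x]
      have := congrArg Subtype.val (h v ⟨x v - compo N N e v (x v), by
        rw [LinearMap.mem_ker]; simp [hce]⟩)
      exact (sub_eq_zero.mp this).symm

theorem iso_of_claim (N W : Repn k Q) (hN : N.Indec) (hNf : N.FinDim) (hW : W.Indec)
    (hWf : W.FinDim) (hd : W.dimv = N.dimv) (hC : TRep.Claim k Q.s Q.t (natc N.dimv)) :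
    Nonempty (Repn.Iso N W) := by
  obtain ⟨f, g, hf, hg, hgf, hfg⟩ := (hC N.toT (N.toT_isRep hNf) (N.toT_ind hN) N.toT_dim).2 W.toT
    (W.toT_isRep hWf) (W.toT_ind hW) (by rw [W.toT_dim, hd])
  refine ⟨⟨fun v => LinearEquiv.ofLinearMap (compo N W f v) (compo W N g v) ?_ ?_, ?_⟩⟩
  · refine LinearMap.ext fun y => ?_
    rw [LinearMap.comp_apply]
    have h1 := compo_apply W N g hg v (Pi.single v y)
    rw [Pi.single_eq_same] at h1
    rw [h1, compo_apply N W f hf v, hfg, Pi.single_eq_same]; rfl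
  · refine LinearMap.ext fun y => ?_
    rw [LinearMap.comp_apply]
    have h1 := compo_apply N W f hf v (Pi.single v y)
    rw [Pi.single_eq_same] at h1
    rw [h1, compo_apply W N g hg v, hgf, Pi.single_eq_same]; rfl
  · exact fun a x => compo_comm N W f hf a x

theorem mem_ker_extMap (N W : Repn k Q) (φ : ∀ v, N.space v →ₗ[k] W.space v) :
    φ ∈ LinearMap.ker (extMap N W) ↔
      ∀ a x, φ (Q.t a) (N.map a x) = W.map a (φ (Q.s a) x) := by
  rw [LinearMap.mem_ker]
  constructor
  · intro h a x
    have h1 := congrArg (fun g : N.space (Q.s a) →ₗ[k] W.space (Q.t a) => g x) (congrFun h a)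
    simp only [extMap, LinearMap.pi_apply, LinearMap.sub_apply] at h1
    exact (sub_eq_zero.mp h1).symm
  · intro h
    funext a
    refine LinearMap.ext fun x => ?_
    exact sub_eq_zero.mpr (h a x).symm

theorem extMap_apply (N W : Repn k Q) (φ : ∀ v, N.space v →ₗ[k] W.space v) (a : Q.A)
    (x : N.space (Q.s a)) :
    extMap N W φ a x = W.map a (φ (Q.s a) x) - φ (Q.t a) (N.map a x) := rfl

theorem ext_euler (N W : Repn k Q) (hN : N.FinDim) (hW : W.FinDim) :
    (homDim N W : ℤ) - extDim N W = eulerZ Q (natc N.dimv) (natc W.dimv) := by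
  have : ∀ v, FiniteDimensional k (N.space v) := hN
  have : ∀ v, FiniteDimensional k (W.space v) := hW
  have h1 := LinearMap.finrank_range_add_finrank_ker (extMap N W)
  have h2 := Submodule.finrank_quotient_add_finrank (LinearMap.range (extMap N W))
  rw [Module.finrank_pi_fintype] at h1 h2
  simp only [Module.finrank_linearMap] at h1 h2
  simp only [homDim, extDim, eulerZ, natc, Repn.dimv]
  zify at h1 h2
  linarith

theorem ext_self_zero (N : Repn k Q) (hN : N.Indec) (hNf : N.FinDim)
    (hC : TRep.Claim k Q.s Q.t (natc N.dimv)) (hq : 0 < titsZ Q (natc N.dimv)) :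
    extDim N N = 0 := by
  have h1 : homDim N N ≤ 1 := by
    refine finrank_le_one (⟨fun v => LinearMap.id, by rw [mem_ker_extMap]; intro a x; rfl⟩ :
      LinearMap.ker (extMap N N)) ?_
    rintro ⟨φ, hφ⟩
    rw [mem_ker_extMap] at hφ
    obtain ⟨c, hc⟩ := (hC N.toT (N.toT_isRep hNf) (N.toT_ind hN) N.toT_dim).1 _
      (totalMap_isHom N N φ hφ)
    refine ⟨c, Subtype.ext ?_⟩
    funext v
    refine LinearMap.ext fun x => ?_
    have h2 := congrFun (hc (Pi.single v x : ∀ v, N.space v)) v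
    rw [totalMap_apply, Pi.single_eq_same] at h2
    rw [h2]
    change c • x = c • (Pi.single v x : ∀ v, N.space v) v
    rw [Pi.single_eq_same]
  have h2 := ext_euler N N hNf hNf
  simp only [titsZ] at hq
  omega

theorem ext_zero_iff (N W : Repn k Q) (hN : N.FinDim) (hW : W.FinDim) :
    extDim N W = 0 ↔ Function.Surjective (extMap N W) := by
  have : ∀ v, FiniteDimensional k (N.space v) := hN
  have : ∀ v, FiniteDimensional k (W.space v) := hW
  rw [← LinearMap.range_eq_top, extDim, Module.finrank_zero_iff, Submodule.Quotient.subsingleton_iff]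

theorem euler_cast (d e : Q.V → ℤ) :
    (eulerZ Q d e : ℚ) = QNum.EF Q.s Q.t (fun v => (d v : ℚ)) (fun v => (e v : ℚ)) := by
  simp [eulerZ, QNum.EF_apply]

theorem affine_facts (k : Type) [Field k] (Q : QuiverData) (δ : Q.V → ℕ)
    (hQ : IsAffine Q) (hnc : ¬ IsOrientedCycle Q) (hδ : IsMinImagRoot Q δ) :
    (∀ D : Finset Q.V, D.Nonempty → ∃ i ∈ D, ∀ a, Q.s a = i → Q.t a ∉ D) ∧
    ∀ x : Q.V → ℤ, defectOf Q δ x < 0 → TRep.Claim k Q.s Q.t x ∧ 0 < titsZ Q x := by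
  obtain ⟨hc, hpz, -⟩ := hQ
  obtain ⟨hδ0, hδq, -⟩ := hδ
  have hp := QNum.psd_transfer Q.s Q.t hpz
  have hac := QNum.acyclic Q.s Q.t hp hc hnc
  refine ⟨hac, fun x hx => ?_⟩
  set δq : Q.V → ℚ := fun v => (natc δ v : ℚ) with hδqd
  have hr : ∀ z, QNum.EF Q.s Q.t δq z + QNum.EF Q.s Q.t z δq = 0 := by
    apply QNum.rad_of_zero Q.s Q.t hp
    rw [hδqd, ← euler_cast]
    exact_mod_cast hδq
  have hpos : ∀ v, 0 < δq v := by
    intro v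
    have h0 : ∀ v, 0 ≤ δq v := fun v => by simp [δq, natc]
    refine lt_of_le_of_ne (h0 v) fun h => hδ0 ?_
    have := QNum.rad_zero Q.s Q.t hc δq h0 hr v h.symm
    funext w
    have h2 := congrFun this w
    simpa [δq, natc] using h2
  have hxq : QNum.EF Q.s Q.t δq (fun v => (x v : ℚ)) < 0 := by
    rw [hδqd, ← euler_cast]
    exact_mod_cast hx
  have hne : Nonempty Q.V := by
    by_contra h
    rw [not_nonempty_iff] at h
    exact hδ0 (Subsingleton.elim _ _)
  refine ⟨TRep.claim_all Q.s Q.t hp hc hac δq hpos hr x hxq, ?_⟩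
  refine lt_of_le_of_ne (hpz x) fun h => ?_
  have h2 := QNum.rad_of_zero Q.s Q.t hp (fun v => (x v : ℚ)) (by
    rw [← euler_cast]
    exact_mod_cast h.symm) δq
  have h3 := QNum.ker_eq Q.s Q.t hc δq hpos hr (fun v => (x v : ℚ)) 
    (QNum.rad_of_zero Q.s Q.t hp (fun v => (x v : ℚ)) (by
    rw [← euler_cast]
    exact_mod_cast h.symm))
  obtain ⟨c, hcx⟩ := h3
  rw [hcx, map_smul] at hxq
  have h4 := hr δq
  have h5 : QNum.EF Q.s Q.t δq δq = 0 := by linarith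
  rw [h5] at hxq
  simp at hxq

end Bridge


section Rads

variable {k : Type} [Field k] {Q : QuiverData}

/-- inverse isomorphism -/
def Repn.Iso.inv {M N : Repn k Q} (f : Repn.Iso M N) : Repn.Iso N M where
  e v := (f.e v).symm
  comm a x := by
    rw [LinearEquiv.symm_apply_eq, f.comm, LinearEquiv.apply_symm_apply]

/-- composition of isomorphisms -/
def Repn.Iso.comp {M N L : Repn k Q} (f : Repn.Iso M N) (g : Repn.Iso N L) : Repn.Iso M L where
  e v := (f.e v).trans (g.e v)
  comm a x := by
    rw [LinearEquiv.trans_apply, LinearEquiv.trans_apply, f.comm, g.comm]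

theorem Subrep.ext_sub {X : Repn k Q} {U W : Subrep X} (h : ∀ v, U.sub v = W.sub v) : U = W := by
  cases U; cases W
  congr
  funext v
  exact h v

theorem simple_struct (hac : ∀ D : Finset Q.V, D.Nonempty → ∃ i ∈ D, ∀ a, Q.s a = i → Q.t a ∉ D)
    (M : Repn k Q) (hMs : IsSimpleRep M) :
    ∃ i, Module.finrank k (M.space i) = 1 ∧ (∀ v, i ≠ v → ∀ x : M.space v, x = 0) := by
  classical
  obtain ⟨h0, hU⟩ := hMs
  obtain ⟨i, hi, hia⟩ := hac (Finset.univ.filter fun v => ∃ x : M.space v, x ≠ 0) (by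
    simp only [Repn.IsZero, not_forall] at h0
    obtain ⟨v, x, hx⟩ := h0
    exact ⟨v, by simp only [Finset.mem_filter, Finset.mem_univ, true_and]; exact ⟨x, hx⟩⟩)
  simp only [Finset.mem_filter, Finset.mem_univ, true_and, not_exists, not_not] at hi hia
  obtain ⟨m, hm⟩ := hi
  have hz : ∀ v (x : M.space v) (c : k), i ≠ v →
      c • (Pi.single i m : ∀ v, M.space v) = Pi.single v x → x = 0 := by
    intro v x c hv h
    have := congrFun h v
    rw [Pi.single_eq_same, Pi.smul_apply, Pi.single_eq_of_ne (Ne.symm hv), smul_zero] at this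
    exact this.symm
  let U : Subrep M := ⟨fun v => (Submodule.span k {(Pi.single i m : ∀ v, M.space v)}).comap
      (LinearMap.single k M.space v), by
    rintro a _ ⟨x, hx, rfl⟩
    have : M.map a x = 0 := by
      by_cases hs : Q.s a = i
      · exact hia a hs _
      · have hx' : LinearMap.single k M.space (Q.s a) x ∈
          (Submodule.span k {(Pi.single i m : ∀ v, M.space v)}) := hx
        obtain ⟨c, hc⟩ := Submodule.mem_span_singleton.mp hx'
        rw [hz _ x c (Ne.symm hs) hc, map_zero]
    rw [this]
    exact Submodule.zero_mem _⟩
  have hUm : m ∈ U.sub i := by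
    change LinearMap.single k M.space i m ∈
      (Submodule.span k {(Pi.single i m : ∀ v, M.space v)})
    exact Submodule.mem_span_singleton_self _
  rcases hU U with h | h
  · exact absurd (congrArg Subtype.val (h i ⟨m, hUm⟩)) hm
  · have hall : ∀ v (x : M.space v), ∃ c : k, c • (Pi.single i m : ∀ v, M.space v)
        = Pi.single v x := by
      intro v x
      have h1 : x ∈ U.sub v := (Submodule.Quotient.mk_eq_zero _).mp (h v (Submodule.Quotient.mk x))
      exact Submodule.mem_span_singleton.mp h1
    refine ⟨i, ?_, ?_⟩
    · refine finrank_eq_one m hm fun w => ?_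
      obtain ⟨c, hc⟩ := hall i w
      refine ⟨c, ?_⟩
      have := congrFun hc i
      rwa [Pi.single_eq_same, Pi.smul_apply, Pi.single_eq_same] at this
    · intro v hv x
      obtain ⟨c, hc⟩ := hall v x
      exact hz v x c hv hc

/-- the span of the images of the arrows ending at `v` -/
def RR (Y : Repn k Q) (v : Q.V) : Submodule k (Y.space v) :=
  ⨆ (a : Q.A) (h : Q.t a = v), h ▸ LinearMap.range (Y.map a)

theorem map_mem_RR (Y : Repn k Q) (a : Q.A) (x : Y.space (Q.s a)) :
    Y.map a x ∈ RR Y (Q.t a) := by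
  have h : LinearMap.range (Y.map a) ≤ RR Y (Q.t a) :=
    le_iSup₂ (f := fun (b : Q.A) (h : Q.t b = Q.t a) => h ▸ LinearMap.range (Y.map b)) a rfl
  exact h ⟨x, rfl⟩

theorem RR_le (Y : Repn k Q) (i : Q.V) (S : ∀ v, Submodule k (Y.space v))
    (h : ∀ a, Q.t a = i → ∀ x, Y.map a x ∈ S (Q.t a)) : RR Y i ≤ S i := by
  refine iSup₂_le fun a ha => ?_
  subst ha
  rintro _ ⟨x, rfl⟩
  exact h a rfl x

/-- the radical with respect to the vertex `i` -/
def Rd (i : Q.V) (Y : Repn k Q) : Subrep Y where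
  sub v := RR Y v ⊔ (if i = v then ⊥ else ⊤)
  stable a := by
    rintro _ ⟨x, _, rfl⟩
    exact Submodule.mem_sup_left (map_mem_RR Y a x)

theorem Rd_self (i : Q.V) (Y : Repn k Q) : (Rd i Y).sub i = RR Y i := by simp [Rd]

theorem Rd_ne (i : Q.V) (Y : Repn k Q) (v : Q.V) (h : i ≠ v) : (Rd i Y).sub v = ⊤ := by
  simp [Rd, h]

/-- inclusion of a subrepresentation -/
def incl {X : Repn k Q} (W : Subrep X) (v : Q.V) : W.repn.space v →ₗ[k] X.space v :=
  (W.sub v).subtype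

theorem incl_inj {X : Repn k Q} (W : Subrep X) (v : Q.V) : Function.Injective (incl W v) :=
  Subtype.val_injective

theorem incl_mem {X : Repn k Q} (W : Subrep X) (v : Q.V) (x : W.repn.space v) :
    incl W v x ∈ W.sub v := Subtype.property x

theorem incl_range {X : Repn k Q} (W : Subrep X) (v : Q.V) :
    LinearMap.range (incl W v) = W.sub v := Submodule.range_subtype _

theorem incl_map {X : Repn k Q} (W : Subrep X) (a : Q.A) (x : W.repn.space (Q.s a)) :
    incl W _ (W.repn.map a x) = X.map a (incl W _ x) := rfl

theorem RR_sub {X : Repn k Q} (W : Subrep X) (i : Q.V) (hl : ∀ a, Q.s a = i → Q.t a ≠ i)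
    (hW : ∀ v, i ≠ v → W.sub v = ⊤) :
    (RR W.repn i).map (incl W i) = RR X i := by
  apply le_antisymm
  · rw [Submodule.map_le_iff_le_comap]
    exact RR_le W.repn i (fun v => (RR X v).comap (incl W v))
      fun a _ x => map_mem_RR X a (incl W _ x)
  · refine RR_le X i (fun v => (RR W.repn v).map (incl W v)) fun a ha x => ?_
    have hx : x ∈ W.sub (Q.s a) := by
      rw [hW _ (fun h => hl a h.symm ha)]; trivial
    exact ⟨W.repn.map a ⟨x, hx⟩, map_mem_RR W.repn a _, rfl⟩

theorem RR_le_sub {X : Repn k Q} (W : Subrep X) (i : Q.V) (hl : ∀ a, Q.s a = i → Q.t a ≠ i)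
    (hW : ∀ v, i ≠ v → W.sub v = ⊤) : RR X i ≤ W.sub i := by
  rw [← RR_sub W i hl hW]
  rintro _ ⟨x, _, rfl⟩
  exact incl_mem W i x

theorem Rd_sub {X : Repn k Q} (W : Subrep X) (i : Q.V) (hl : ∀ a, Q.s a = i → Q.t a ≠ i)
    (hW : ∀ v, i ≠ v → W.sub v = ⊤) :
    Nonempty (Repn.Iso (Rd i W.repn).repn (Rd i X).repn) := by
  have h : ∀ v, ((Rd i W.repn).sub v).map (incl W v) = (Rd i X).sub v := by
    intro v
    by_cases hv : i = v
    · subst hv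
      rw [Rd_self, Rd_self]
      exact RR_sub W i hl hW
    · rw [Rd_ne _ _ _ hv, Rd_ne _ _ _ hv, Submodule.map_top, incl_range, hW v hv]
  refine ⟨⟨fun v => (Submodule.equivMapOfInjective (incl W v) (incl_inj W v)
    ((Rd i W.repn).sub v)).trans (LinearEquiv.ofEq _ _ (h v)), ?_⟩⟩
  intro a x
  exact Subtype.ext rfl

theorem RR_iso {Y Z : Repn k Q} (f : Repn.Iso Y Z) (v : Q.V) :
    (RR Y v).map (f.e v).toLinearMap = RR Z v := by
  apply le_antisymm
  · rw [Submodule.map_le_iff_le_comap]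
    refine RR_le Y v (fun v => (RR Z v).comap (f.e v).toLinearMap) fun a _ x => ?_
    rw [Submodule.mem_comap]
    change f.e _ _ ∈ _
    rw [f.comm]
    exact map_mem_RR Z a _
  · refine RR_le Z v (fun v => (RR Y v).map (f.e v).toLinearMap) fun a _ x => ?_
    refine ⟨Y.map a ((f.e _).symm x), map_mem_RR Y a _, ?_⟩
    change f.e _ _ = _
    rw [f.comm, LinearEquiv.apply_symm_apply]

theorem Rd_iso (i : Q.V) {Y Z : Repn k Q} (f : Repn.Iso Y Z) :
    Nonempty (Repn.Iso (Rd i Y).repn (Rd i Z).repn) := by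
  have h : ∀ v, ((Rd i Y).sub v).map (f.e v).toLinearMap = (Rd i Z).sub v := by
    intro v
    by_cases hv : i = v
    · subst hv
      rw [Rd_self, Rd_self, RR_iso]
    · rw [Rd_ne _ _ _ hv, Rd_ne _ _ _ hv, Submodule.map_top]
      exact LinearEquiv.range _
  refine ⟨⟨fun v => ((f.e v).submoduleMap ((Rd i Y).sub v)).trans
    (LinearEquiv.ofEq _ _ (h v)), ?_⟩⟩
  intro a x
  exact Subtype.ext (f.comm a x.1)

/-- codimension of the radical -/
noncomputable def cdim (i : Q.V) (Y : Repn k Q) : ℕ := Module.finrank k (Y.space i ⧸ RR Y i)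

theorem cdim_iso (i : Q.V) {Y Z : Repn k Q} (f : Repn.Iso Y Z) : cdim i Y = cdim i Z :=
  LinearEquiv.finrank_eq (Submodule.Quotient.equiv _ _ (f.e i) (RR_iso f i))

/-- extend a family -/
theorem fam_extend {Y Z : Repn k Q} (i : Q.V) (g : Y.space i →ₗ[k] Z.space i)
    (hZ : ∀ v, i ≠ v → ∀ x : Z.space v, x = 0) (hg : RR Y i ≤ LinearMap.ker g)
    (hl : ∀ a, Q.s a = i → Q.t a ≠ i) :
    ∃ F : RepHom Y Z, F.toFun i = g := by
  have : ∀ v, ∃ φ : Y.space v →ₗ[k] Z.space v, ∀ h : i = v, HEq φ g := by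
    intro v
    by_cases h : i = v
    · subst h; exact ⟨g, fun _ => HEq.rfl⟩
    · exact ⟨0, fun h' => absurd h' h⟩
  choose φ hφ using this
  have hi : φ i = g := eq_of_heq (hφ i rfl)
  refine ⟨⟨φ, fun a => LinearMap.ext fun x => ?_⟩, hi⟩
  simp only [LinearMap.comp_apply]
  by_cases h : i = Q.t a
  · have h1 : φ (Q.s a) x = 0 := hZ _ (fun hs => hl a hs.symm h.symm) _
    rw [h1, map_zero]
    subst h
    rw [hi]
    exact (hg (map_mem_RR Y a x)).symm
  · rw [hZ _ h (φ _ _), hZ _ h (Z.map a _)]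

theorem iso_extend {Y Z : Repn k Q} (i : Q.V) (g : Y.space i ≃ₗ[k] Z.space i)
    (hY : ∀ v, i ≠ v → ∀ x : Y.space v, x = 0)
    (hZ : ∀ v, i ≠ v → ∀ x : Z.space v, x = 0)
    (hl : ∀ a, Q.s a = i → Q.t a ≠ i) :
    ∃ F : Repn.Iso Y Z, F.e i = g := by
  have : ∀ v, ∃ φ : Y.space v ≃ₗ[k] Z.space v, ∀ h : i = v, HEq φ g := by
    intro v
    by_cases h : i = v
    · subst h; exact ⟨g, fun _ => HEq.rfl⟩
    · have h1 : Subsingleton (Y.space v) := ⟨fun x y => by rw [hY v h x, hY v h y]⟩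
      have h2 : Subsingleton (Z.space v) := ⟨fun x y => by rw [hZ v h x, hZ v h y]⟩
      exact ⟨LinearEquiv.ofLinearMap 0 0 (LinearMap.ext fun _ => Subsingleton.elim _ _)
        (LinearMap.ext fun _ => Subsingleton.elim _ _), fun h' => absurd h' h⟩
  choose φ hφ using this
  have hi : φ i = g := eq_of_heq (hφ i rfl)
  refine ⟨⟨φ, fun a x => ?_⟩, hi⟩
  by_cases h : i = Q.t a
  · have hs : i ≠ Q.s a := fun hs => hl a hs.symm h.symm
    rw [hY _ hs x, map_zero, map_zero, map_zero, map_zero]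
  · rw [hZ _ h (φ _ _), hZ _ h (Z.map a _)]

theorem hom_cdim (i : Q.V) (Y M : Repn k Q) (hYf : Y.FinDim) 
    (hM1 : Module.finrank k (M.space i) = 1)
    (hM : ∀ v, i ≠ v → ∀ x : M.space v, x = 0)
    (hl : ∀ a, Q.s a = i → Q.t a ≠ i) : homDim Y M = cdim i Y := by
  have : ∀ v, FiniteDimensional k (Y.space v) := hYf
  have : FiniteDimensional k (M.space i) := Module.finite_of_finrank_pos (by omega)
  have hker : ∀ φ ∈ LinearMap.ker (extMap Y M), RR Y i ≤ LinearMap.ker (φ i) := by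
    intro φ hφ
    rw [mem_ker_extMap] at hφ
    refine RR_le Y i (fun v => LinearMap.ker (φ v)) fun a ha x => ?_
    rw [LinearMap.mem_ker, hφ, hM _ (fun h => hl a h.symm ha) (φ _ x), map_zero]
  let f : LinearMap.ker (extMap Y M) →ₗ[k] (Y.space i ⧸ RR Y i →ₗ[k] M.space i) :=
    { toFun := fun φ => (RR Y i).liftQ (φ.1 i) (hker φ.1 φ.2)
      map_add' := fun φ ψ => by
        refine Submodule.linearMap_qext _ (LinearMap.ext fun x => ?_); rfl
      map_smul' := fun c φ => by
        refine Submodule.linearMap_qext _ (LinearMap.ext fun x => ?_); rfl }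
  have hf : ∀ φ x, f φ (Submodule.Quotient.mk x) = φ.1 i x := fun φ x => rfl
  have hb : Function.Bijective f := by
    constructor
    · intro φ ψ h
      refine Subtype.ext (funext fun v => LinearMap.ext fun x => ?_)
      by_cases hv : i = v
      · subst hv
        rw [← hf, ← hf, h]
      · rw [hM v hv (φ.1 v x), hM v hv (ψ.1 v x)]
    · intro g
      obtain ⟨F, hF⟩ := fam_extend (Y := Y) (Z := M) i (g ∘ₗ (RR Y i).mkQ) hM (by
        intro x hx
        rw [LinearMap.mem_ker, LinearMap.comp_apply, Submodule.mkQ_apply,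
          (Submodule.Quotient.mk_eq_zero _).mpr hx, map_zero]) hl
      refine ⟨⟨F.toFun, ?_⟩, ?_⟩
      · rw [mem_ker_extMap]
        intro a x
        exact (congrArg (fun g : Y.space (Q.s a) →ₗ[k] M.space (Q.t a) => g x) (F.comm a)).symm
      · refine Submodule.linearMap_qext _ (LinearMap.ext fun x => ?_)
        change F.toFun i x = _
        rw [hF]
  have h2 := LinearEquiv.finrank_eq (LinearEquiv.ofBijective f hb)
  rw [homDim, h2, Module.finrank_linearMap, hM1, mul_one, cdim]

/-- `X/W ≅ Z` for `Z` concentrated at `i` -/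
theorem quot_iso_iff {X : Repn k Q} (W : Subrep X) (Z : Repn k Q) (i : Q.V) (hXf : X.FinDim)
    (hZf : FiniteDimensional k (Z.space i))
    (hZ : ∀ v, i ≠ v → ∀ x : Z.space v, x = 0)
    (hl : ∀ a, Q.s a = i → Q.t a ≠ i) :
    Nonempty (Repn.Iso W.quot Z) ↔ (∀ v, i ≠ v → W.sub v = ⊤) ∧
      Module.finrank k (X.space i ⧸ W.sub i) = Module.finrank k (Z.space i) := by
  have : ∀ v, FiniteDimensional k (X.space v) := hXf
  constructor
  · rintro ⟨F⟩
    refine ⟨fun v hv => ?_, (F.e i).finrank_eq⟩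
    rw [eq_top_iff]
    rintro x -
    rw [← Submodule.Quotient.mk_eq_zero (W.sub v)]
    exact (F.e v).map_eq_zero_iff.mp (hZ v hv (F.e v _))
  · rintro ⟨h1, h2⟩
    have hfq : FiniteDimensional k (W.quot.space i) :=
      inferInstanceAs (FiniteDimensional k (X.space i ⧸ W.sub i))
    obtain ⟨F, -⟩ := iso_extend (Y := W.quot) (Z := Z) i (LinearEquiv.ofFinrankEq _ _ h2) (by
      intro v hv x
      obtain ⟨y, rfl⟩ := Submodule.Quotient.mk_surjective (W.sub v) x
      refine (Submodule.Quotient.mk_eq_zero _).mpr ?_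
      rw [h1 v hv]; trivial) hZ hl
    exact ⟨F⟩

theorem eq_of_codim {E : Type} [AddCommGroup E] [Module k E] [FiniteDimensional k E]
    {p q : Submodule k E} (h : p ≤ q) (hd : Module.finrank k (E ⧸ p) = Module.finrank k (E ⧸ q)) :
    p = q := by
  have h1 := Submodule.finrank_quotient_add_finrank p
  have h2 := Submodule.finrank_quotient_add_finrank q
  exact Submodule.eq_of_le_of_finrank_eq h (by omega)

theorem eq_Rd {X : Repn k Q} (hXf : X.FinDim) (i : Q.V) (W : Subrep X)
    (hl : ∀ a, Q.s a = i → Q.t a ≠ i)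
    (h1 : ∀ v, i ≠ v → W.sub v = ⊤)
    (h2 : Module.finrank k (X.space i ⧸ W.sub i) = cdim i X) : W = Rd i X := by
  have : ∀ v, FiniteDimensional k (X.space v) := hXf
  refine Subrep.ext_sub fun v => ?_
  by_cases hv : i = v
  · subst hv
    rw [Rd_self]
    exact (eq_of_codim (RR_le_sub W i hl h1) h2.symm).symm
  · rw [h1 v hv, Rd_ne _ _ _ hv]

theorem cdim_sub {X : Repn k Q} (hXf : X.FinDim) (i : Q.V) (W : Subrep X)
    (hl : ∀ a, Q.s a = i → Q.t a ≠ i)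
    (h1 : ∀ v, i ≠ v → W.sub v = ⊤) :
    cdim i X = cdim i W.repn + Module.finrank k (X.space i ⧸ W.sub i) := by
  have : ∀ v, FiniteDimensional k (X.space v) := hXf
  have e1 := Submodule.finrank_quotient_add_finrank (RR X i)
  have e2 := Submodule.finrank_quotient_add_finrank (W.sub i)
  have hfw : FiniteDimensional k (W.repn.space i) :=
    inferInstanceAs (FiniteDimensional k (W.sub i))
  have e3 := Submodule.finrank_quotient_add_finrank (RR W.repn i)
  have e4 : Module.finrank k (RR W.repn i) = Module.finrank k (RR X i) := by
    rw [← RR_sub W i hl h1]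
    exact (Submodule.equivMapOfInjective (incl W i) (incl_inj W i) (RR W.repn i)).finrank_eq
  have e5 : Module.finrank k (W.repn.space i) = Module.finrank k (W.sub i) := rfl
  rw [cdim, cdim]
  omega

theorem cdim_Rd {X : Repn k Q} (hXf : X.FinDim) (i : Q.V) 
    (hl : ∀ a, Q.s a = i → Q.t a ≠ i) : RR (Rd i X).repn i = ⊤ := by
  have : ∀ v, FiniteDimensional k (X.space v) := hXf
  have h := cdim_sub hXf i (Rd i X) hl (fun v hv => Rd_ne i X v hv)
  rw [Rd_self] at h
  have h2 : cdim i (Rd i X).repn = 0 := by rw [cdim] at h; omega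
  have h3 : FiniteDimensional k ((Rd i X).sub i) := inferInstance
  have h4 : FiniteDimensional k ((Rd i X).repn.space i) := h3
  rw [cdim, Module.finrank_zero_iff, Submodule.Quotient.subsingleton_iff] at h2
  exact h2

theorem ext_sub_zero {N : Repn k Q} (P : Subrep N) (h : Function.Surjective (extMap N N)) :
    Function.Surjective (extMap P.repn N) := by
  intro ψ
  have : ∀ a, ∃ g : N.space (Q.s a) →ₗ[k] N.space (Q.t a), g ∘ₗ (P.sub (Q.s a)).subtype = ψ a :=
    fun a => LinearMap.exists_extend (ψ a)
  choose g hg using this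
  obtain ⟨φ, hφ⟩ := h g
  refine ⟨fun v => φ v ∘ₗ (P.sub v).subtype, ?_⟩
  funext a
  refine LinearMap.ext fun x => ?_
  have h1 := congrArg (fun l : N.space (Q.s a) →ₗ[k] N.space (Q.t a) => l x.1) (congrFun hφ a)
  have h2 := congrArg (fun l : P.sub (Q.s a) →ₗ[k] N.space (Q.t a) => l x) (hg a)
  exact h1.trans h2

theorem ext_Rd_zero {N : Repn k Q} (hNf : N.FinDim) (i : Q.V) 
    (hl : ∀ a, Q.s a = i → Q.t a ≠ i) (h : Function.Surjective (extMap N N)) :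
    Function.Surjective (extMap (Rd i N).repn (Rd i N).repn) := by
  intro ψ
  obtain ⟨φ, hφ⟩ := ext_sub_zero (Rd i N) h (fun a => ((Rd i N).sub (Q.t a)).subtype ∘ₗ ψ a)
  have hφ' : ∀ a (x : (Rd i N).sub (Q.s a)),
      N.map a (φ (Q.s a) x) - φ (Q.t a) ((Rd i N).repn.map a x) = (ψ a x : (Rd i N).sub (Q.t a)).1 := by
    intro a x
    exact congrArg (fun l : (Rd i N).sub (Q.s a) →ₗ[k] N.space (Q.t a) => l x) (congrFun hφ a)
  have hmem : ∀ v x, φ v x ∈ (Rd i N).sub v := by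
    intro v x
    by_cases hv : i = v
    · subst hv
      have h1 := RR_le (Rd i N).repn i (fun v => ((Rd i N).sub v).comap (φ v)) (by
        intro a _ x
        rw [Submodule.mem_comap]
        have : φ (Q.t a) ((Rd i N).repn.map a x) =
            N.map a (φ (Q.s a) x) - (ψ a x : (Rd i N).sub (Q.t a)).1 := by
          rw [← hφ' a x]; abel
        rw [this]
        exact Submodule.sub_mem _ (Submodule.mem_sup_left (map_mem_RR N a _))
          (ψ a x : (Rd i N).sub (Q.t a)).2)
      rw [cdim_Rd hNf i hl] at h1
      exact h1 (Submodule.mem_top (x := x))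
    · rw [Rd_ne _ _ _ hv]; trivial
  refine ⟨fun v => LinearMap.codRestrict ((Rd i N).sub v) (φ v) (hmem v), ?_⟩
  funext a
  refine LinearMap.ext fun x => ?_
  refine Subtype.ext ?_
  exact hφ' a x

end Rads


section Counting

variable {k : Type} [Field k] {Q : QuiverData}

theorem hyper_count [Finite k] (Z : Type) [AddCommGroup Z] [Module k Z] [FiniteDimensional k Z] :
    ((Nat.card k : ℤ) - 1) * (Nat.card {K : Submodule k Z // Module.finrank k (Z ⧸ K) = 1} : ℤ)
      = (Nat.card k : ℤ) ^ (Module.finrank k Z) - 1 := by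
  have e : {K : Submodule k Z // Module.finrank k (Z ⧸ K) = 1} ≃
      {H : Submodule k (Module.Dual k Z) // Module.finrank k H = 1} :=
    Equiv.subtypeEquiv
      ((Subspace.orderIsoFiniteDimensional (K := k) (V := Z)).toEquiv.trans OrderDual.ofDual)
      (by
        intro W
        change _ ↔ Module.finrank k (Submodule.dualAnnihilator W) = 1
        have h1 := Subspace.finrank_add_finrank_dualAnnihilator_eq W
        have h2 := Submodule.finrank_quotient_add_finrank W
        omega)
  have : Finite (Module.Dual k Z) := Module.finite_of_finite k
  have h1 := Projectivization.card' k (Module.Dual k Z)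
  rw [Nat.card_congr e, ← Nat.card_congr (Projectivization.equivSubmodule k (Module.Dual k Z))]
  rw [Module.natCard_eq_pow_finrank (K := k), Subspace.dual_finrank_eq] at h1
  have h2 : 1 ≤ Nat.card k := Nat.card_pos
  zify [h2] at h1
  rw [h1]; ring

theorem Subrep.finite_of [Finite k] {X : Repn k Q} (hXf : X.FinDim) : Finite (Subrep X) := by
  have : ∀ v, FiniteDimensional k (X.space v) := hXf
  have : ∀ v, Finite (X.space v) := fun v => Module.finite_of_finite k
  exact Finite.of_injective (fun W : Subrep X => W.sub)
    fun U W h => Subrep.ext_sub fun v => congrFun h v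

theorem max_count [Finite k] (i : Q.V) (X M : Repn k Q) (hXf : X.FinDim)
    (hM1 : Module.finrank k (M.space i) = 1)
    (hM : ∀ v, i ≠ v → ∀ x : M.space v, x = 0)
    (hl : ∀ a, Q.s a = i → Q.t a ≠ i) :
    ((Nat.card k : ℤ) - 1) * (Nat.card {W : Subrep X // Nonempty (Repn.Iso W.quot M)} : ℤ)
      = (Nat.card k : ℤ) ^ (cdim i X) - 1 := by
  have : ∀ v, FiniteDimensional k (X.space v) := hXf
  have hMf : FiniteDimensional k (M.space i) := Module.finite_of_finrank_pos (by omega)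
  have hq := fun W : Subrep X => quot_iso_iff W M i hXf hMf hM hl
  rw [cdim, ← hyper_count (k := k) (X.space i ⧸ RR X i)]
  congr 2
  refine Nat.card_congr (Equiv.ofBijective (fun W => ⟨(W.1.sub i).map (RR X i).mkQ, ?_⟩) ⟨?_, ?_⟩)
  · have h := (hq W.1).1 W.2
    rw [← hM1, ← h.2]
    exact LinearEquiv.finrank_eq
      (Submodule.quotientQuotientEquivQuotient _ _ (RR_le_sub W.1 i hl h.1))
  · rintro ⟨U, hU⟩ ⟨W, hW⟩ h
    have h1 := (hq U).1 hU
    have h2 := (hq W).1 hW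
    have h3 : (U.sub i).map (RR X i).mkQ = (W.sub i).map (RR X i).mkQ := congrArg Subtype.val h
    apply Subtype.ext
    refine Subrep.ext_sub fun v => ?_
    by_cases hv : i = v
    · subst hv
      have h4 := congrArg (Submodule.comap (RR X i).mkQ) h3
      rw [Submodule.comap_map_mkQ, Submodule.comap_map_mkQ,
        sup_eq_right.2 (RR_le_sub U i hl h1.1), sup_eq_right.2 (RR_le_sub W i hl h2.1)] at h4
      exact h4
    · rw [h1.1 v hv, h2.1 v hv]
  · rintro ⟨K, hK⟩
    have : ∀ v, ∃ S : Submodule k (X.space v),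
        (∀ _ : i = v, HEq S (K.comap (RR X i).mkQ)) ∧ (i ≠ v → S = ⊤) ∧ RR X v ≤ S := by
      intro v
      by_cases h : i = v
      · subst h
        refine ⟨K.comap (RR X i).mkQ, fun _ => HEq.rfl, fun h => absurd rfl h, ?_⟩
        intro x hx
        rw [Submodule.mem_comap, (Submodule.Quotient.mk_eq_zero _).2 hx |> fun h : (RR X i).mkQ x = 0 => h]
        exact K.zero_mem
      · exact ⟨⊤, fun h2 => absurd h2 h, fun _ => rfl, le_top⟩
    choose S hS1 hS2 hS3 using this
    have hSi : S i = K.comap (RR X i).mkQ := eq_of_heq (hS1 i rfl)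
    let W : Subrep X := ⟨S, by
      rintro a _ ⟨x, _, rfl⟩
      exact hS3 _ (map_mem_RR X a x)⟩
    have hmap : (S i).map (RR X i).mkQ = K := by
      rw [hSi, Submodule.map_comap_eq_of_surjective (Submodule.mkQ_surjective _)]
    refine ⟨⟨W, (hq W).2 ⟨fun v hv => hS2 v hv, ?_⟩⟩, Subtype.ext hmap⟩
    rw [hM1, ← hK, ← hmap]
    exact (LinearEquiv.finrank_eq
      (Submodule.quotientQuotientEquivQuotient _ _ (hS3 i))).symm

theorem not_decomp_iff (Y : Repn k Q) (h0 : ¬ Y.IsZero) : ¬ IsDecomposableRep Y ↔ Y.Indec := by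
  constructor
  · intro h
    refine ⟨h0, fun A B hAB => ?_⟩
    by_contra hc
    push Not at hc
    exact h ⟨A, B, hc.1, hc.2, hAB⟩
  · rintro ⟨_, h⟩ ⟨A, B, hA, hB, hAB⟩
    rcases h A B hAB with h | h
    · exact hA h
    · exact hB h

theorem pow_zero_away (i : Q.V) (M : Repn k Q) (d : ℕ)
    (hM : ∀ v, i ≠ v → ∀ x : M.space v, x = 0) : ∀ v, i ≠ v → ∀ x : (M.pow d).space v, x = 0 := by
  intro v hv x
  funext j
  exact hM v hv (x j)

theorem pow_fin (M : Repn k Q) (d : ℕ) (i : Q.V) (hM : FiniteDimensional k (M.space i)) :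
    FiniteDimensional k ((M.pow d).space i) :=
  inferInstanceAs (FiniteDimensional k (Fin d → M.space i))

theorem pow_finrank (M : Repn k Q) (d : ℕ) (i : Q.V) (hM : Module.finrank k (M.space i) = 1) :
    Module.finrank k ((M.pow d).space i) = d := by
  have : FiniteDimensional k (M.space i) := Module.finite_of_finrank_pos (by omega)
  have h : Module.finrank k (Fin d → M.space i) = d := by
    rw [Module.finrank_pi_fintype]; simp [hM]
  exact h

theorem hom_RR_le {Y Z : Repn k Q} (i : Q.V) (f : RepHom Y Z)
    (hZ : ∀ v, i ≠ v → ∀ x : Z.space v, x = 0)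
    (hl : ∀ a, Q.s a = i → Q.t a ≠ i) : RR Y i ≤ LinearMap.ker (f.toFun i) := by
  refine RR_le Y i (fun v => LinearMap.ker (f.toFun v)) fun a ha x => ?_
  rw [LinearMap.mem_ker]
  have h := LinearMap.congr_fun (f.comm a) x
  simp only [LinearMap.comp_apply] at h
  rw [← h, hZ (Q.s a) (fun h => hl a h.symm ha) (f.toFun _ x), map_zero]

theorem ker_eq_RR {Y Z : Repn k Q} (hYf : Y.FinDim) (i : Q.V) (f : RepHom Y Z)
    (hZ : ∀ v, i ≠ v → ∀ x : Z.space v, x = 0)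
    (hl : ∀ a, Q.s a = i → Q.t a ≠ i) (hd : Module.finrank k (Z.space i) = cdim i Y)
    (hf : Function.Surjective (f.toFun i)) : LinearMap.ker (f.toFun i) = RR Y i := by
  have : ∀ v, FiniteDimensional k (Y.space v) := hYf
  refine (eq_of_codim (hom_RR_le i f hZ hl) ?_).symm
  rw [LinearEquiv.finrank_eq ((f.toFun i).quotKerEquivOfSurjective hf), hd, cdim]

theorem kerSub_eq {Y Z : Repn k Q} (hYf : Y.FinDim) (i : Q.V) (f : RepHom Y Z)
    (hZ : ∀ v, i ≠ v → ∀ x : Z.space v, x = 0)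
    (hl : ∀ a, Q.s a = i → Q.t a ≠ i) (hd : Module.finrank k (Z.space i) = cdim i Y)
    (hf : Function.Surjective (f.toFun i)) : f.kerSub = Rd i Y := by
  refine Subrep.ext_sub fun v => ?_
  by_cases hv : i = v
  · subst hv
    rw [Rd_self]
    exact ker_eq_RR hYf i f hZ hl hd hf
  · rw [Rd_ne i Y v hv, eq_top_iff]
    intro x _
    exact hZ v hv _

theorem exists_epi {Y Z : Repn k Q} (i : Q.V) (hYf : Y.FinDim)
    (hZf : FiniteDimensional k (Z.space i))
    (hZ : ∀ v, i ≠ v → ∀ x : Z.space v, x = 0)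
    (hl : ∀ a, Q.s a = i → Q.t a ≠ i) (hd : Module.finrank k (Z.space i) = cdim i Y) :
    ∃ f : RepHom Y Z, ∀ v, Function.Surjective (f.toFun v) := by
  have : ∀ v, FiniteDimensional k (Y.space v) := hYf
  have e : (Y.space i ⧸ RR Y i) ≃ₗ[k] Z.space i := LinearEquiv.ofFinrankEq _ _ hd.symm
  obtain ⟨F, hF⟩ := fam_extend (Y := Y) (Z := Z) i (e.toLinearMap ∘ₗ (RR Y i).mkQ) hZ (by
    intro x hx
    rw [LinearMap.mem_ker, LinearMap.comp_apply,
      show (RR Y i).mkQ x = 0 from (Submodule.Quotient.mk_eq_zero _).2 hx, map_zero]) hl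
  refine ⟨F, fun v => ?_⟩
  by_cases hv : i = v
  · subst hv
    rw [hF]
    exact e.surjective.comp (Submodule.mkQ_surjective _)
  · intro z
    exact ⟨0, by rw [hZ v hv z, map_zero]⟩

theorem epi_unique {Y Z : Repn k Q} (i : Q.V) (hYf : Y.FinDim)
    (hZ : ∀ v, i ≠ v → ∀ x : Z.space v, x = 0)
    (hl : ∀ a, Q.s a = i → Q.t a ≠ i) (hd : Module.finrank k (Z.space i) = cdim i Y)
    (f g : RepHom Y Z) (hf : ∀ v, Function.Surjective (f.toFun v))
    (hg : ∀ v, Function.Surjective (g.toFun v)) :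
    ∃ θ : Repn.Iso Z Z, ∀ v x, g.toFun v x = (θ.e v) (f.toFun v x) := by
  have hk : LinearMap.ker (f.toFun i) = LinearMap.ker (g.toFun i) := by
    rw [ker_eq_RR hYf i f hZ hl hd (hf i), ker_eq_RR hYf i g hZ hl hd (hg i)]
  let e1 := (f.toFun i).quotKerEquivOfSurjective (hf i)
  let e2 := (g.toFun i).quotKerEquivOfSurjective (hg i)
  obtain ⟨θ, hθ⟩ := iso_extend (Y := Z) (Z := Z) i
    ((e1.symm.trans (Submodule.quotEquivOfEq _ _ hk)).trans e2) hZ hZ hl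
  refine ⟨θ, fun v x => ?_⟩
  by_cases hv : i = v
  · subst hv
    rw [hθ]
    have h1 : e1.symm (f.toFun i x) = Submodule.Quotient.mk x := by
      rw [LinearEquiv.symm_apply_eq]; rfl
    rw [LinearEquiv.trans_apply, LinearEquiv.trans_apply, h1]
    rfl
  · rw [hZ v hv (g.toFun v x), hZ v hv (θ.e v _)]

/-- the unique inner subrepresentation -/
theorem inner_unique {X N M : Repn k Q} (i : Q.V) (hXf : X.FinDim)
    (hM1 : Module.finrank k (M.space i) = 1)
    (hM : ∀ v, i ≠ v → ∀ x : M.space v, x = 0)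
    (hl : ∀ a, Q.s a = i → Q.t a ≠ i)
    (U : Subrep X) (hU1 : Nonempty (Repn.Iso U.repn N)) (hU2 : Nonempty (Repn.Iso U.quot M))
    (W : Subrep X) (hW : Nonempty (Repn.Iso W.quot M)) :
    ∃! V : Subrep W.repn, Nonempty (Repn.Iso V.repn (Rd i N).repn) ∧
      Nonempty (Repn.Iso V.quot (M.pow (cdim i N))) := by
  have : ∀ v, FiniteDimensional k (X.space v) := hXf
  have hWf : W.repn.FinDim := fun v => inferInstanceAs (FiniteDimensional k (W.sub v))
  have hMf : FiniteDimensional k (M.space i) := Module.finite_of_finrank_pos (by omega)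
  have hq := fun W : Subrep X => quot_iso_iff W M i hXf hMf hM hl
  have hq2 := fun V : Subrep W.repn => quot_iso_iff V (M.pow (cdim i N)) i hWf
    (pow_fin M _ i hMf) (pow_zero_away i M _ hM) hl
  have hu := (hq U).1 hU2
  have hw := (hq W).1 hW
  obtain ⟨fU⟩ := hU1
  have c1 := cdim_sub hXf i U hl hu.1
  have c2 := cdim_sub hXf i W hl hw.1
  have c3 := cdim_iso i fU
  have c4 : cdim i W.repn = cdim i N := by omega
  refine ⟨Rd i W.repn, ⟨?_, (hq2 _).2 ⟨fun v hv => Rd_ne i _ v hv, ?_⟩⟩, ?_⟩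
  · obtain ⟨g1⟩ := Rd_sub W i hl hw.1
    obtain ⟨g2⟩ := Rd_sub U i hl hu.1
    obtain ⟨g3⟩ := Rd_iso i fU
    exact ⟨(g1.comp g2.inv).comp g3⟩
  · rw [pow_finrank M _ i hM1, Rd_self, ← c4, cdim]
  · rintro V ⟨_, hV⟩
    have hv := (hq2 V).1 hV
    refine eq_Rd hWf i V hl hv.1 ?_
    rw [hv.2, pow_finrank M _ i hM1, c4]

theorem dimv_eq_of {X N M : Repn k Q} (hXf : X.FinDim)
    (U : Subrep X) (hU1 : Nonempty (Repn.Iso U.repn N)) (hU2 : Nonempty (Repn.Iso U.quot M))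
    (W : Subrep X) (hW : Nonempty (Repn.Iso W.quot M)) : W.repn.dimv = N.dimv := by
  have : ∀ v, FiniteDimensional k (X.space v) := hXf
  obtain ⟨f⟩ := hU1
  obtain ⟨g⟩ := hU2
  obtain ⟨h⟩ := hW
  funext v
  have h1 : Module.finrank k (U.sub v) = Module.finrank k (N.space v) := LinearEquiv.finrank_eq (f.e v)
  have h2 : Module.finrank k (X.space v ⧸ U.sub v) = Module.finrank k (M.space v) :=
    LinearEquiv.finrank_eq (g.e v)
  have h3 : Module.finrank k (X.space v ⧸ W.sub v) = Module.finrank k (M.space v) :=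
    LinearEquiv.finrank_eq (h.e v)
  have h4 := Submodule.finrank_quotient_add_finrank (U.sub v)
  have h5 := Submodule.finrank_quotient_add_finrank (W.sub v)
  change Module.finrank k (W.sub v) = Module.finrank k (N.space v)
  omega

theorem indec_iso {Y Z : Repn k Q} (f : Repn.Iso Y Z) (h : Z.Indec) : Y.Indec := by
  refine ⟨fun h0 => h.1 fun v z => ?_, fun A B hAB => h.2 A B ?_⟩
  · rw [← (f.e v).apply_symm_apply z, h0 v ((f.e v).symm z), map_zero]
  · obtain ⟨g⟩ := hAB
    exact ⟨f.inv.comp g⟩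

theorem zero_of_dimv {Y Z : Repn k Q} (hZf : Z.FinDim) (h : Y.dimv = Z.dimv) (hY : Y.IsZero) :
    Z.IsZero := by
  have : ∀ v, FiniteDimensional k (Z.space v) := hZf
  intro v z
  have h1 : Module.finrank k (Y.space v) = Module.finrank k (Z.space v) := congrFun h v
  have : Subsingleton (Y.space v) := ⟨fun a b => by rw [hY v a, hY v b]⟩
  rw [Module.finrank_zero_of_subsingleton] at h1
  have := Module.finrank_zero_iff.1 h1.symm
  exact Subsingleton.elim _ _

end Counting

theorem simple_preinjective_hall_number_formula
    (Q : QuiverData) (δ : Q.V → ℕ)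
    (hQ : IsAffine Q) (hnc : ¬ IsOrientedCycle Q) (hδ : IsMinImagRoot Q δ)
    (k : Type) [Field k] [Fintype k]
    (M N : Repn k Q)
    (hMf : M.FinDim) (hMs : IsSimpleRep M)
    (hMpi : 0 < defectOf Q δ (natc (Repn.dimv M)))
    (hNf : N.FinDim) (hNind : N.Indec)
    (hNpp : defectOf Q δ (natc (Repn.dimv N)) < 0) :
    ∃ f : RepHom N (M.pow (homDim N M)),
      (∀ v, Function.Surjective (f.toFun v)) ∧
      (∀ g : RepHom N (M.pow (homDim N M)),
        (∀ v, Function.Surjective (g.toFun v)) →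
        ∃ θ : Repn.Iso (M.pow (homDim N M)) (M.pow (homDim N M)),
          ∀ v x, g.toFun v x = (θ.e v) (f.toFun v x)) ∧
      homDim (f.kerSub).repn M = 0 ∧
      extDim (f.kerSub).repn N = 0 ∧
      extDim (f.kerSub).repn (f.kerSub).repn = 0 ∧
      (∀ X : Repn k Q, X.FinDim →
        (IsHomogRegular δ X ∨ SingleNonHomogTube δ X) →
        (∃ U : Subrep X, Nonempty (Repn.Iso U.repn N) ∧ Nonempty (Repn.Iso U.quot M)) →
        ((Fintype.card k : ℤ) - 1) * (hallNum M N X : ℤ)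
          = (Fintype.card k : ℤ) ^ (homDim N M + 1) - 1
            - ((Fintype.card k : ℤ) - 1) *
              (Nat.card (Σ W : {W : Subrep X // Nonempty (Repn.Iso W.quot M) ∧
                    IsDecomposableRep W.repn},
                {V : Subrep (W.1.repn) // Nonempty (Repn.Iso V.repn (f.kerSub).repn) ∧
                  Nonempty (Repn.Iso V.quot (M.pow (homDim N M)))}) : ℤ)) := by
  classical
  obtain ⟨hac, hcl⟩ := affine_facts k Q δ hQ hnc hδ
  obtain ⟨hC, hq⟩ := hcl _ hNpp
  obtain ⟨i, hM1, hM⟩ := simple_struct hac M hMs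
  have hl : ∀ a, Q.s a = i → Q.t a ≠ i := by
    obtain ⟨j, hj, hja⟩ := hac {i} ⟨i, Finset.mem_singleton_self i⟩
    rw [Finset.mem_singleton] at hj
    subst hj
    intro a ha hb
    exact hja a ha (Finset.mem_singleton.2 hb)
  have hMi := hMf i
  have hNv : ∀ v, FiniteDimensional k (N.space v) := hNf
  have hd := hom_cdim i N M hNf hM1 hM hl
  rw [hd]
  have hp0 := pow_zero_away i M (cdim i N) hM
  have hpd := pow_finrank M (cdim i N) i hM1
  obtain ⟨f, hf⟩ := exists_epi (Y := N) (Z := M.pow (cdim i N)) i hNf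
    (pow_fin M _ i hMi) hp0 hl hpd
  have hk := kerSub_eq hNf i f hp0 hl hpd (hf i)
  have hPf : (Rd i N).repn.FinDim := fun v =>
    inferInstanceAs (FiniteDimensional k ((Rd i N).sub v))
  have hsurj : Function.Surjective (extMap N N) :=
    (ext_zero_iff N N hNf hNf).1 (ext_self_zero N hNind hNf hC hq)
  refine ⟨f, hf, fun g hg => epi_unique i hNf hp0 hl hpd f g hf hg, ?_⟩
  rw [hk]
  refine ⟨?_, ?_, ?_, ?_⟩
  · rw [hom_cdim i _ M hPf hM1 hM hl, cdim, cdim_Rd hNf i hl]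
    exact Module.finrank_zero_of_subsingleton
  · exact (ext_zero_iff _ _ hPf hNf).2 (ext_sub_zero _ hsurj)
  · exact (ext_zero_iff _ _ hPf hPf).2 (ext_Rd_zero hNf i hl hsurj)
  · rintro X hXf - ⟨U, hU1, hU2⟩
    have hXv : ∀ v, FiniteDimensional k (X.space v) := hXf
    have hfin : Finite (Subrep X) := Subrep.finite_of hXf
    have hmax := max_count i X M hXf hM1 hM hl
    have hcX : cdim i X = cdim i N + 1 := by
      have hu := (quot_iso_iff U M i hXf hMi hM hl).1 hU2
      have c1 := cdim_sub hXf i U hl hu.1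
      obtain ⟨fU⟩ := hU1
      have c3 := cdim_iso i fU
      omega
    have hsig : Nat.card (Σ W : {W : Subrep X // Nonempty (Repn.Iso W.quot M) ∧
          IsDecomposableRep W.repn},
        {V : Subrep (W.1.repn) // Nonempty (Repn.Iso V.repn (Rd i N).repn) ∧
          Nonempty (Repn.Iso V.quot (M.pow (cdim i N)))}) =
        Nat.card {W : Subrep X // Nonempty (Repn.Iso W.quot M) ∧ IsDecomposableRep W.repn} := by
      refine Nat.card_congr (Equiv.ofBijective Sigma.fst ⟨?_, ?_⟩)
      · rintro ⟨W, V⟩ ⟨W2, V2⟩ h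
        change W = W2 at h
        subst h
        have hu := inner_unique i hXf hM1 hM hl U hU1 hU2 W.1 W.2.1
        rw [Subtype.ext (hu.unique V.2 V2.2)]
      · intro W
        obtain ⟨V, hV, _⟩ := inner_unique i hXf hM1 hM hl U hU1 hU2 W.1 W.2.1
        exact ⟨⟨W, V, hV⟩, rfl⟩
    have hiff : ∀ W : Subrep X, Nonempty (Repn.Iso W.quot M) →
        (Nonempty (Repn.Iso W.repn N) ↔ ¬ IsDecomposableRep W.repn) := by
      intro W hW
      have hWf : W.repn.FinDim := fun v => inferInstanceAs (FiniteDimensional k (W.sub v))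
      have hdv := dimv_eq_of hXf U hU1 hU2 W hW
      have h0 : ¬ W.repn.IsZero := fun h => hNind.1 (zero_of_dimv hNf hdv h)
      rw [not_decomp_iff _ h0]
      constructor
      · rintro ⟨g⟩
        exact indec_iso g hNind
      · intro hWi
        obtain ⟨g⟩ := iso_of_claim N W.repn hNind hNf hWi hWf hdv hC
        exact ⟨g.inv⟩
    have hsum : Nat.card {W : Subrep X // Nonempty (Repn.Iso W.quot M)} =
        hallNum M N X +
        Nat.card {W : Subrep X // Nonempty (Repn.Iso W.quot M) ∧ IsDecomposableRep W.repn} := by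
      have e1 : {W : Subrep X // Nonempty (Repn.Iso W.repn N) ∧ Nonempty (Repn.Iso W.quot M)} ≃
          {W : {W : Subrep X // Nonempty (Repn.Iso W.quot M)} // ¬ IsDecomposableRep W.1.repn} :=
        (Equiv.subtypeEquivRight (q := fun W : Subrep X => Nonempty (Repn.Iso W.quot M) ∧ ¬ IsDecomposableRep W.repn) fun W => by
          constructor
          · rintro ⟨h1, h2⟩
            exact ⟨h2, (hiff W h2).1 h1⟩
          · rintro ⟨h2, h1⟩
            exact ⟨(hiff W h2).2 h1, h2⟩).trans
          (Equiv.subtypeSubtypeEquivSubtypeInter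
            (fun W : Subrep X => Nonempty (Repn.Iso W.quot M))
            (fun W : Subrep X => ¬ IsDecomposableRep W.repn)).symm
      have e2 : {W : Subrep X // Nonempty (Repn.Iso W.quot M) ∧ IsDecomposableRep W.repn} ≃
          {W : {W : Subrep X // Nonempty (Repn.Iso W.quot M)} // IsDecomposableRep W.1.repn} :=
        (Equiv.subtypeSubtypeEquivSubtypeInter
            (fun W : Subrep X => Nonempty (Repn.Iso W.quot M))
            (fun W : Subrep X => IsDecomposableRep W.repn)).symm
      rw [hallNum, Nat.card_congr e1, Nat.card_congr e2, add_comm, ← Nat.card_sum]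
      exact Nat.card_congr (Equiv.sumCompl _).symm
    rw [hsig]
    rw [hcX, hsum, Nat.card_eq_fintype_card] at hmax
    push_cast at hmax ⊢
    linarith
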